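/- arXiv:1510.07190 — 2 statements merged into one kernel-verified Lean document; each statement's English description precedes it below -/
import Mathlib

section
/- Let p ≥ 3 and let τ = τ_1⋯τ_p ∈ S_p be minimal overlapping with τ_1 = 1 and τ_p = s where 2 ≤ s < p. Then IU_{τ,1}(q,z) = −z, and for all n ≥ 2, IU_{τ,n}(q,z) = (1−z)·IU_{τ,n−1}(q,z) − z^{des(τ)} q^{inv(τ)} [n−s choose p−s]_q · IU_{τ,n−p+1}(q,z), where [a choose b]_q is taken to be 0 whenever a < b (so the last term vanishes for 2 ≤ n < p). -/
open scoped Classical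

noncomputable section

namespace CWilf

/-- The number of descents of a permutation of `{0, …, n-1}` (0-based). -/
def des {n : ℕ} (σ : Equiv.Perm (Fin n)) : ℕ :=
  (Finset.univ.filter fun i : Fin n =>
    ∃ h : (i : ℕ) + 1 < n, σ ⟨(i : ℕ) + 1, h⟩ < σ i).card

/-- The number of inversions of `σ`. -/
def inv {n : ℕ} (σ : Equiv.Perm (Fin n)) : ℕ :=
  (Finset.univ.filter fun q : Fin n × Fin n => q.1 < q.2 ∧ σ q.2 < σ q.1).card

/-- The number of coinversions of `σ`. -/
def coinv {n : ℕ} (σ : Equiv.Perm (Fin n)) : ℕ :=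
  (Finset.univ.filter fun q : Fin n × Fin n => q.1 < q.2 ∧ σ q.1 < σ q.2).card

/-- The number of left-to-right minima of `σ`. -/
def LRmin {n : ℕ} (σ : Equiv.Perm (Fin n)) : ℕ :=
  (Finset.univ.filter fun j : Fin n => ∀ i : Fin n, i < j → σ j < σ i).card

/-- There is a `τ`-match of `σ` starting at (0-based) position `i`, i.e.
`red(σ_i σ_{i+1} ⋯ σ_{i+j-1}) = τ`. -/
def MatchAt {j n : ℕ} (τ : Equiv.Perm (Fin j)) (σ : Equiv.Perm (Fin n)) (i : ℕ) : Prop :=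
  ∃ h : i + j ≤ n, ∀ a b : Fin j,
    τ a < τ b ↔
      σ ⟨i + (a : ℕ), by have := a.isLt; omega⟩ < σ ⟨i + (b : ℕ), by have := b.isLt; omega⟩

/-- The number of `τ`-matches of `σ`. -/
def mch {j n : ℕ} (τ : Equiv.Perm (Fin j)) (σ : Equiv.Perm (Fin n)) : ℕ :=
  ((Finset.range n).filter fun i => MatchAt τ σ i).card

/-- `τ` is minimal overlapping: the smallest `n` such that some `σ ∈ S_n` has
exactly two `τ`-matches is `2j - 1`. -/
def MinOverlapping {j : ℕ} (τ : Equiv.Perm (Fin j)) : Prop :=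
  IsLeast {n : ℕ | ∃ σ : Equiv.Perm (Fin n), mch τ σ = 2} (2 * j - 1)

/-- `α` and `β` are mutually minimal overlapping. -/
def MutuallyMinOverlapping {j : ℕ} (α β : Equiv.Perm (Fin j)) : Prop :=
  MinOverlapping α ∧ MinOverlapping β ∧
    IsLeast {n : ℕ | ∃ σ : Equiv.Perm (Fin n), 1 ≤ mch α σ ∧ 1 ≤ mch β σ} (2 * j - 1)

/-- The set of permutations of `S_n` with no `τ`-match. -/
def NM (n : ℕ) {j : ℕ} (τ : Equiv.Perm (Fin j)) : Finset (Equiv.Perm (Fin n)) :=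
  Finset.univ.filter fun σ => mch τ σ = 0

/-- The `p,q`-analogue `[n]_{p,q} = p^{n-1} + p^{n-2}q + ⋯ + q^{n-1}`. -/
def pqInt {K : Type} [CommSemiring K] (p q : K) (n : ℕ) : K :=
  ∑ i ∈ Finset.range n, p ^ (n - 1 - i) * q ^ i

/-- The `p,q`-factorial `[n]_{p,q}!`. -/
def pqFact {K : Type} [CommSemiring K] (p q : K) : ℕ → K
  | 0 => 1
  | n + 1 => pqFact p q n * pqInt p q (n + 1)

/-- The `p,q`-binomial coefficient, taken to be `0` when `k > n`. -/
def pqBinom {K : Type} [Field K] (p q : K) (n k : ℕ) : K :=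
  if k ≤ n then pqFact p q n / (pqFact p q k * pqFact p q (n - k)) else 0

/-- The `q`-analogue `[n]_q = 1 + q + ⋯ + q^{n-1}`. -/
def qInt {K : Type} [CommSemiring K] (q : K) (n : ℕ) : K :=
  ∑ i ∈ Finset.range n, q ^ i

/-- The `q`-factorial `[n]_q!`. -/
def qFact {K : Type} [CommSemiring K] (q : K) : ℕ → K
  | 0 => 1
  | n + 1 => qFact q n * qInt q (n + 1)

/-- The `q`-binomial coefficient, taken to be `0` when `k > n`. -/
def qBinom {K : Type} [Field K] (q : K) (n k : ℕ) : K :=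
  if k ≤ n then qFact q n / (qFact q k * qFact q (n - k)) else 0

/-- `mp_{τ, n(j-1)+1}(p,q)`, the generating polynomial
`Σ_{σ ∈ MP_{τ,n(j-1)+1}} q^{inv σ} p^{coinv σ}` over maximum packings for `τ`. -/
def mpSum {j : ℕ} (τ : Equiv.Perm (Fin j)) (n : ℕ) {K : Type} [CommSemiring K] (p q : K) : K :=
  ∑ σ ∈ Finset.univ.filter (fun σ : Equiv.Perm (Fin (n * (j - 1) + 1)) => mch τ σ = n),
    q ^ inv σ * p ^ coinv σ

/-- The field `ℚ(p,q)` of rational functions in two variables. -/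
abbrev K2 : Type := FractionRing (MvPolynomial (Fin 2) ℚ)

/-- The variable `p` in `ℚ(p,q)`. -/
def pW : K2 := algebraMap (MvPolynomial (Fin 2) ℚ) K2 (MvPolynomial.X 0)
/-- The variable `q` in `ℚ(p,q)`. -/
def qW : K2 := algebraMap (MvPolynomial (Fin 2) ℚ) K2 (MvPolynomial.X 1)

/-- `INM_{τ,n}(q,z)`, with `INM_{τ,0}(q,z) = 1` and
`INM_{τ,n}(q,z) = Σ_{σ∈NM_n(τ)} z^{des σ + 1} q^{inv σ}` for `n ≥ 1`. -/
def INM {p : ℕ} (τ : Equiv.Perm (Fin p)) (n : ℕ) {K : Type} [CommSemiring K]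
    (q z : K) : K :=
  if n = 0 then 1 else ∑ σ ∈ NM n τ, z ^ (des σ + 1) * q ^ inv σ

/-- The words that list the elements of `S` once each. -/
def arrangements (S : Finset ℕ) : Finset (List ℕ) := S.val.lists.toFinset

/-- The number of inversions of a word. -/
def listInv : List ℕ → ℕ
  | [] => 0
  | x :: w => w.countP (· < x) + listInv w

/-- The number of pairs `(x, y) ∈ T × U` with `y < x`. -/
def crossInv (T U : Finset ℕ) : ℕ := ∑ x ∈ T, (U.filter (· < x)).card

theorem mem_arrangements {S : Finset ℕ} {w : List ℕ} :
    w ∈ arrangements S ↔ w.Nodup ∧ w.toFinset = S := by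
  unfold arrangements
  rw [Multiset.mem_toFinset, Multiset.mem_lists_iff]
  constructor
  · intro h
    have hn : w.Nodup := by
      have := S.nodup
      rw [h] at this
      exact this
    refine ⟨hn, ?_⟩
    apply Finset.val_injective
    rw [h, List.toFinset_val, hn.dedup]
    rfl
  · rintro ⟨hn, rfl⟩
    rw [List.toFinset_val, hn.dedup]
    rfl

theorem length_of_mem_arrangements {S : Finset ℕ} {w : List ℕ} (h : w ∈ arrangements S) :
    w.length = S.card := by
  obtain ⟨hn, rfl⟩ := mem_arrangements.1 h
  exact (List.toFinset_card_of_nodup hn).symm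

theorem mem_of_mem_arrangements {S : Finset ℕ} {w : List ℕ} (h : w ∈ arrangements S) {x : ℕ} :
    x ∈ w ↔ x ∈ S := by
  obtain ⟨hn, rfl⟩ := mem_arrangements.1 h
  simp

theorem countP_of_mem_arrangements {S : Finset ℕ} {w : List ℕ} (h : w ∈ arrangements S) (x : ℕ) :
    w.countP (· < x) = (S.filter (· < x)).card := by
  obtain ⟨hn, rfl⟩ := mem_arrangements.1 h
  rw [List.countP_eq_length_filter, ← List.toFinset_card_of_nodup (hn.filter _)]
  congr 1
  ext y
  simp

theorem listInv_append (u v : List ℕ) :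
    listInv (u ++ v) = listInv u + listInv v + (u.map fun x => v.countP (· < x)).sum := by
  induction u with
  | nil => simp [listInv]
  | cons x u ih =>
    simp only [List.cons_append, listInv, ih, List.countP_append, List.map_cons, List.sum_cons]
    ring

theorem listInv_append_of_mem {T U : Finset ℕ} {u v : List ℕ} (hu : u ∈ arrangements T)
    (hv : v ∈ arrangements U) :
    listInv (u ++ v) = listInv u + listInv v + crossInv T U := by
  rw [listInv_append]
  congr 1
  obtain ⟨hn, rfl⟩ := mem_arrangements.1 hu
  rw [crossInv, List.sum_toFinset _ hn]
  congr 1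
  apply List.map_congr_left
  intro x _
  exact countP_of_mem_arrangements hv x

theorem append_mem_arrangements {T U : Finset ℕ} (h : Disjoint T U) {u v : List ℕ}
    (hu : u ∈ arrangements T) (hv : v ∈ arrangements U) : u ++ v ∈ arrangements (T ∪ U) := by
  obtain ⟨hn, rfl⟩ := mem_arrangements.1 hu
  obtain ⟨hn', rfl⟩ := mem_arrangements.1 hv
  refine mem_arrangements.2 ⟨?_, by simp⟩
  rw [List.nodup_append']
  exact ⟨hn, hn', by
    intro a ha hb
    exact Finset.disjoint_left.1 h (by simpa using ha) (by simpa using hb)⟩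

theorem sum_arrangements_split {M : Type} [AddCommMonoid M] {S : Finset ℕ} {k : ℕ}
    (hk : k ≤ S.card) (g : List ℕ → M) :
    ∑ w ∈ arrangements S, g w = ∑ T ∈ S.powersetCard k,
      ∑ u ∈ arrangements T, ∑ v ∈ arrangements (S \ T), g (u ++ v) := by
  simp_rw [← Finset.sum_product']
  rw [Finset.sum_sigma']
  refine Finset.sum_bij' (fun w _ => ⟨(w.take k).toFinset, (w.take k, w.drop k)⟩)
    (fun x _ => x.2.1 ++ x.2.2) ?_ ?_ ?_ ?_ ?_
  · intro w hw
    have hl := length_of_mem_arrangements hw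
    obtain ⟨hn, rfl⟩ := mem_arrangements.1 hw
    have hd : (w.take k ++ w.drop k).Nodup := by rwa [List.take_append_drop]
    rw [List.nodup_append'] at hd
    simp only [Finset.mem_sigma, Finset.mem_powersetCard, Finset.mem_product, mem_arrangements]
    refine ⟨⟨?_, ?_⟩, ⟨hd.1, trivial⟩, hd.2.1, ?_⟩
    · intro x hx
      simp only [List.mem_toFinset] at hx ⊢
      exact List.mem_of_mem_take hx
    · rw [List.toFinset_card_of_nodup hd.1, List.length_take]
      omega
    · ext x
      have : x ∈ w ↔ x ∈ w.take k ∨ x ∈ w.drop k := by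
        rw [← List.mem_append, List.take_append_drop]
      simp only [List.mem_toFinset, Finset.mem_sdiff, this]
      have := @hd.2.2 x
      tauto
  · rintro ⟨T, u, v⟩ h
    simp only [Finset.mem_sigma, Finset.mem_powersetCard, Finset.mem_product] at h
    have := append_mem_arrangements Finset.disjoint_sdiff h.2.1 h.2.2
    rwa [Finset.union_sdiff_of_subset h.1.1] at this
  · intro w hw
    simp
  · rintro ⟨T, u, v⟩ h
    simp only [Finset.mem_sigma, Finset.mem_powersetCard, Finset.mem_product] at h
    have hl := length_of_mem_arrangements h.2.1
    have hT := (mem_arrangements.1 h.2.1).2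
    have ht : (u ++ v).take k = u := List.take_left' (by omega)
    have hd : (u ++ v).drop k = v := List.drop_left' (by omega)
    simp [ht, hd, hT]
  · intro w hw
    simp

theorem exists_strictMono_image_range (T : Finset ℕ) :
    ∃ g : ℕ → ℕ, StrictMono g ∧ (Finset.range T.card).image g = T := by
  induction T using Finset.induction_on_max with
  | empty => exact ⟨id, strictMono_id, by simp⟩
  | insert a T ha ih =>
    obtain ⟨g, hg, hT⟩ := ih
    have hmem : ∀ i < T.card, g i < a := fun i hi =>
      ha _ (by rw [← hT]; exact Finset.mem_image_of_mem _ (by simpa using hi))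
    refine ⟨fun i => if i < T.card then g i else a + (i - T.card), ?_, ?_⟩
    · intro i j hij
      dsimp only
      split_ifs with h1 h2 h2
      · exact hg hij
      · have := hmem i h1
        omega
      · omega
      · omega
    · have haT : a ∉ T := fun h => lt_irrefl _ (ha a h)
      rw [Finset.card_insert_of_notMem haT, Finset.range_add_one, Finset.image_insert]
      simp only [lt_irrefl, if_false, Nat.sub_self, add_zero]
      congr 1
      conv_rhs => rw [← hT]
      apply Finset.image_congr
      intro i hi
      simp only [Finset.coe_range, Set.mem_Iio] at hi
      simp [hi]

theorem listInv_map {g : ℕ → ℕ} (hg : StrictMono g) (w : List ℕ) :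
    listInv (w.map g) = listInv w := by
  induction w with
  | nil => rfl
  | cons x w ih =>
    simp only [List.map_cons, listInv, ih, List.countP_map]
    congr 2
    ext y
    simp [hg.lt_iff_lt]

theorem arrangements_image {g : ℕ → ℕ} (hg : StrictMono g) (S : Finset ℕ) :
    arrangements (S.image g) = (arrangements S).image (List.map g) := by
  ext w
  simp only [Finset.mem_image, mem_arrangements]
  constructor
  · rintro ⟨hn, hw⟩
    have hmem : ∀ x ∈ w, g (Function.invFun g x) = x := by
      intro x hx
      have : x ∈ S.image g := by rw [← hw]; simpa using hx
      obtain ⟨y, -, rfl⟩ := Finset.mem_image.1 this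
      rw [Function.leftInverse_invFun hg.injective]
    have hmap : (w.map (Function.invFun g)).map g = w := by
      rw [List.map_map]
      exact (List.map_congr_left hmem).trans (List.map_id w)
    refine ⟨w.map (Function.invFun g), ⟨?_, ?_⟩, hmap⟩
    · apply List.Nodup.of_map g
      rwa [hmap]
    · apply Finset.image_injective hg.injective
      rw [← hw]
      conv_rhs => rw [← hmap]
      ext x
      simp
  · rintro ⟨v, ⟨hn, rfl⟩, rfl⟩
    refine ⟨hn.map hg.injective, ?_⟩
    ext x
    simp

/-- A statistic on words that depends only on the relative order of the letters. -/
def OrderInvariant {K : Type} (φ : List ℕ → K) : Prop :=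
  ∀ g : ℕ → ℕ, StrictMono g → ∀ w, φ (w.map g) = φ w

section WordSums

variable {K : Type} [Field K] (q : K)

/-- The inversion generating function of a statistic over the words on `{0, …, n-1}`. -/
def invSum (φ : List ℕ → K) (n : ℕ) : K :=
  ∑ w ∈ arrangements (Finset.range n), q ^ listInv w * φ w

/-- The generating function of the inversions between a `k`-subset and its complement. -/
def gaussSum (S : Finset ℕ) (k : ℕ) : K :=
  ∑ T ∈ S.powersetCard k, q ^ crossInv T (S \ T)

theorem sum_arrangements_eq_invSum {φ : List ℕ → K} (hφ : OrderInvariant φ) (S : Finset ℕ) :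
    ∑ w ∈ arrangements S, q ^ listInv w * φ w = invSum q φ S.card := by
  obtain ⟨g, hg, hS⟩ := exists_strictMono_image_range S
  rw [invSum]
  conv_lhs => rw [← hS]
  rw [arrangements_image hg, Finset.sum_image]
  · exact Finset.sum_congr rfl fun w _ => by rw [listInv_map hg, hφ g hg]
  · exact fun _ _ _ _ h => List.map_injective_iff.2 hg.injective h

theorem sum_arrangements_take_drop {φ ψ : List ℕ → K} (hφ : OrderInvariant φ)
    (hψ : OrderInvariant ψ) {S : Finset ℕ} {k : ℕ} (hk : k ≤ S.card) :
    ∑ w ∈ arrangements S, q ^ listInv w * (φ (w.take k) * ψ (w.drop k)) =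
      gaussSum q S k * invSum q φ k * invSum q ψ (S.card - k) := by
  rw [sum_arrangements_split hk, gaussSum, Finset.sum_mul, Finset.sum_mul]
  refine Finset.sum_congr rfl fun T hT => ?_
  obtain ⟨hTS, hTk⟩ := Finset.mem_powersetCard.1 hT
  have h1 := sum_arrangements_eq_invSum q hφ T
  have h2 := sum_arrangements_eq_invSum q hψ (S \ T)
  rw [hTk] at h1
  rw [Finset.card_sdiff_of_subset hTS, hTk] at h2
  rw [← h1, ← h2, mul_assoc, Finset.sum_mul_sum, Finset.mul_sum]
  refine Finset.sum_congr rfl fun u hu => ?_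
  rw [Finset.mul_sum]
  refine Finset.sum_congr rfl fun v hv => ?_
  have hl : u.length = k := by rw [length_of_mem_arrangements hu, hTk]
  rw [List.take_left' hl, List.drop_left' hl, listInv_append_of_mem hu hv]
  ring

theorem orderInvariant_one : OrderInvariant (fun _ => (1 : K)) := fun _ _ _ => rfl

theorem arrangements_empty : arrangements ∅ = {[]} := by
  ext w
  simp only [mem_arrangements, List.toFinset_eq_empty_iff, Finset.mem_singleton]
  constructor
  · exact And.right
  · rintro rfl
    simp

theorem arrangements_singleton (x : ℕ) : arrangements {x} = {[x]} := by
  ext w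
  rw [Finset.mem_singleton]
  constructor
  · intro h
    have hl := length_of_mem_arrangements h
    rw [Finset.card_singleton, List.length_eq_one_iff] at hl
    obtain ⟨y, rfl⟩ := hl
    have := (mem_of_mem_arrangements h (x := y)).1 (by simp)
    simp_all
  · rintro rfl
    simp [mem_arrangements]

theorem invSum_zero (φ : List ℕ → K) : invSum q φ 0 = φ [] := by
  simp [invSum, arrangements_empty, listInv]

theorem invSum_one (φ : List ℕ → K) : invSum q φ 1 = φ [0] := by
  simp [invSum, arrangements_singleton, listInv]

theorem gaussSum_range_one (n : ℕ) : gaussSum q (Finset.range n) 1 = qInt q n := by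
  rw [gaussSum, Finset.powersetCard_one, Finset.sum_map, qInt]
  refine Finset.sum_congr rfl fun x hx => ?_
  have : (Finset.range n \ {x}).filter (· < x) = Finset.range x := by
    ext y
    simp only [Finset.mem_filter, Finset.mem_sdiff, Finset.mem_range, Finset.mem_singleton] at hx ⊢
    omega
  simp [crossInv, this]

theorem invSum_const_one (n : ℕ) : invSum q (fun _ => 1) n = qFact q n := by
  induction n with
  | zero => simp [invSum_zero, qFact]
  | succ n ih =>
    have h := sum_arrangements_take_drop q (φ := fun _ => 1) (ψ := fun _ => 1) (k := 1)
      orderInvariant_one orderInvariant_one (S := Finset.range (n + 1)) (by simp)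
    rw [gaussSum_range_one, invSum_one, Finset.card_range, Nat.add_sub_cancel, ih] at h
    rw [invSum, qFact, mul_comm (qFact q n)]
    simpa using h

variable {q} in
theorem gaussSum_eq_qBinom (hq : ∀ n, qFact q n ≠ 0) (S : Finset ℕ) (k : ℕ) :
    gaussSum q S k = qBinom q S.card k := by
  rw [qBinom]
  split_ifs with hk
  · have h := sum_arrangements_take_drop q (φ := fun _ => 1) (ψ := fun _ => 1)
      orderInvariant_one orderInvariant_one hk
    rw [invSum_const_one, invSum_const_one] at h
    have h' := sum_arrangements_eq_invSum q orderInvariant_one S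
    rw [invSum_const_one] at h'
    simp only [mul_one] at h h'
    rw [h'] at h
    rw [eq_div_iff (mul_ne_zero (hq _) (hq _)), h, mul_assoc]
  · rw [gaussSum, Finset.powersetCard_eq_empty.2 (by omega), Finset.sum_empty]

end WordSums

/-- The word `σ 0, σ 1, …, σ (n-1)` of a permutation. -/
def permWord {n : ℕ} (σ : Equiv.Perm (Fin n)) : List ℕ := List.ofFn fun i => (σ i : ℕ)

/-- The first `p` letters of `w` are in the same relative order as `τ`. -/
def HeadMatch {p : ℕ} (τ : Equiv.Perm (Fin p)) (w : List ℕ) : Prop :=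
  p ≤ w.length ∧ ∀ a b : Fin p, τ a < τ b ↔ w.getD a 0 < w.getD b 0

/-- No factor of `w` is in the same relative order as `τ`. -/
def Avoids {p : ℕ} (τ : Equiv.Perm (Fin p)) (w : List ℕ) : Prop :=
  ∀ i, ¬ HeadMatch τ (w.drop i)

/-- The number of descents of a word. -/
def listDes (w : List ℕ) : ℕ :=
  ∑ i ∈ Finset.range (w.length - 1), if w.getD (i + 1) 0 < w.getD i 0 then 1 else 0

theorem length_permWord {n : ℕ} (σ : Equiv.Perm (Fin n)) : (permWord σ).length = n := by
  simp [permWord]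

theorem getD_permWord {n : ℕ} (σ : Equiv.Perm (Fin n)) {i : ℕ} (h : i < n) :
    (permWord σ).getD i 0 = σ ⟨i, h⟩ := by
  simp [permWord, List.getD, h]

theorem permWord_mem_arrangements {n : ℕ} (σ : Equiv.Perm (Fin n)) :
    permWord σ ∈ arrangements (Finset.range n) := by
  refine mem_arrangements.2 ⟨?_, ?_⟩
  · exact List.nodup_ofFn.2 (Fin.val_injective.comp σ.injective)
  · ext x
    simp only [permWord, List.mem_toFinset, List.mem_ofFn, Finset.mem_range]
    constructor
    · rintro ⟨i, rfl⟩
      exact (σ i).2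
    · intro h
      exact ⟨σ.symm ⟨x, h⟩, by simp⟩

theorem exists_permWord_eq {n : ℕ} {w : List ℕ} (hw : w ∈ arrangements (Finset.range n)) :
    ∃ σ : Equiv.Perm (Fin n), permWord σ = w := by
  have hl : w.length = n := by rw [length_of_mem_arrangements hw, Finset.card_range]
  have hlt : ∀ i : Fin n, w.get (i.cast hl.symm) < n := fun i =>
    Finset.mem_range.1 ((mem_of_mem_arrangements hw).1 (List.get_mem _ _))
  have hinj : Function.Injective fun i : Fin n => (⟨w.get (i.cast hl.symm), hlt i⟩ : Fin n) := by
    intro i j hij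
    simp only [Fin.mk.injEq] at hij
    have := List.nodup_iff_injective_get.1 (mem_arrangements.1 hw).1 hij
    simpa using this
  refine ⟨Equiv.ofBijective _ (Finite.injective_iff_bijective.1 hinj), ?_⟩
  apply List.ext_getElem
  · rw [length_permWord, hl]
  · intro i h1 h2
    simp [permWord]

theorem permWord_injective {n : ℕ} : Function.Injective (permWord (n := n)) := by
  intro σ σ' h
  ext i
  exact congrFun (List.ofFn_injective h) i

theorem sum_permWord {M : Type} [AddCommMonoid M] (n : ℕ) (g : List ℕ → M) :
    ∑ σ : Equiv.Perm (Fin n), g (permWord σ) = ∑ w ∈ arrangements (Finset.range n), g w := by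
  refine Finset.sum_bij (fun σ _ => permWord σ) (fun σ _ => permWord_mem_arrangements σ)
    (fun _ _ _ _ h => permWord_injective h) (fun w hw => ?_) (fun _ _ => rfl)
  obtain ⟨σ, rfl⟩ := exists_permWord_eq hw
  exact ⟨σ, Finset.mem_univ _, rfl⟩

theorem countP_ofFn_eq_sum {n : ℕ} (f : Fin n → ℕ) (x : ℕ) :
    (List.ofFn f).countP (· < x) = ∑ j, if f j < x then 1 else 0 := by
  induction n with
  | zero => simp
  | succ n ih =>
    rw [List.ofFn_succ, List.countP_cons, ih, Fin.sum_univ_succ, add_comm]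
    simp

theorem listInv_ofFn {n : ℕ} (f : Fin n → ℕ) :
    listInv (List.ofFn f) = ∑ i, ∑ j, if i < j ∧ f j < f i then 1 else 0 := by
  induction n with
  | zero => simp [listInv]
  | succ n ih =>
    rw [List.ofFn_succ, listInv, ih]
    simp only [Fin.sum_univ_succ, false_and, if_false, zero_add, Fin.succ_pos, true_and,
      Fin.not_lt_zero, Fin.succ_lt_succ_iff]
    rw [countP_ofFn_eq_sum]

theorem listInv_permWord {n : ℕ} (σ : Equiv.Perm (Fin n)) : listInv (permWord σ) = inv σ := by
  rw [permWord, listInv_ofFn, inv, Finset.card_filter, ← Finset.univ_product_univ,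
    Finset.sum_product]
  simp only [Fin.val_fin_lt]

theorem listDes_permWord {n : ℕ} (σ : Equiv.Perm (Fin n)) : listDes (permWord σ) = des σ := by
  have key : des σ = ∑ i ∈ Finset.range n, if i + 1 < n ∧
      (permWord σ).getD (i + 1) 0 < (permWord σ).getD i 0 then 1 else 0 := by
    rw [des, Finset.card_filter, ← Fin.sum_univ_eq_sum_range (fun i => if i + 1 < n ∧
      (permWord σ).getD (i + 1) 0 < (permWord σ).getD i 0 then 1 else 0)]
    refine Finset.sum_congr rfl fun i _ => ?_
    refine if_congr ?_ rfl rfl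
    rw [← exists_prop]
    refine exists_congr fun h => ?_
    rw [getD_permWord σ h, getD_permWord σ i.2, Fin.val_fin_lt]
  rw [key, listDes, length_permWord]
  cases n with
  | zero => rfl
  | succ n =>
    rw [Finset.sum_range_succ, if_neg (by omega), add_zero, Nat.add_sub_cancel]
    refine Finset.sum_congr rfl fun i hi => if_congr ?_ rfl rfl
    rw [Finset.mem_range] at hi
    exact (and_iff_right (by omega)).symm

theorem getD_drop_eq (w : List ℕ) (i j : ℕ) : (w.drop i).getD j 0 = w.getD (i + j) 0 := by
  simp [List.getD]

theorem getD_take_eq (w : List ℕ) {m j : ℕ} (h : j < m) : (w.take m).getD j 0 = w.getD j 0 := by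
  simp [List.getD, h]

theorem getD_map_lt {g : ℕ → ℕ} (hg : StrictMono g) {w : List ℕ} {i j : ℕ} (hi : i < w.length)
    (hj : j < w.length) : (w.map g).getD i 0 < (w.map g).getD j 0 ↔ w.getD i 0 < w.getD j 0 := by
  simp [List.getD, hi, hj, hg.lt_iff_lt]

theorem headMatch_map {p : ℕ} (τ : Equiv.Perm (Fin p)) {g : ℕ → ℕ} (hg : StrictMono g)
    (w : List ℕ) : HeadMatch τ (w.map g) ↔ HeadMatch τ w := by
  unfold HeadMatch
  rw [List.length_map]
  refine and_congr_right fun h => ?_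
  refine forall_congr' fun a => forall_congr' fun b => ?_
  rw [getD_map_lt hg (a.2.trans_le h) (b.2.trans_le h)]

theorem headMatch_take {p : ℕ} (τ : Equiv.Perm (Fin p)) (w : List ℕ) (m : ℕ) :
    HeadMatch τ (w.take m) ↔ p ≤ m ∧ HeadMatch τ w := by
  unfold HeadMatch
  rw [List.length_take, le_min_iff, and_assoc]
  refine and_congr_right fun h => and_congr_right fun _ => ?_
  refine forall_congr' fun a => forall_congr' fun b => ?_
  rw [getD_take_eq _ (a.2.trans_le h), getD_take_eq _ (b.2.trans_le h)]

theorem matchAt_iff_headMatch {p n : ℕ} (hp : 0 < p) (τ : Equiv.Perm (Fin p))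
    (σ : Equiv.Perm (Fin n)) (i : ℕ) : MatchAt τ σ i ↔ HeadMatch τ ((permWord σ).drop i) := by
  unfold MatchAt HeadMatch
  rw [List.length_drop, length_permWord]
  have hlen : i + p ≤ n ↔ p ≤ n - i := by omega
  rw [← hlen, ← exists_prop]
  refine exists_congr fun h => ?_
  refine forall_congr' fun a => forall_congr' fun b => ?_
  rw [getD_drop_eq, getD_drop_eq, getD_permWord σ (by have := a.2; omega),
    getD_permWord σ (by have := b.2; omega), Fin.val_fin_lt]

theorem mch_eq_zero_iff {p n : ℕ} (hp : 0 < p) (τ : Equiv.Perm (Fin p))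
    (σ : Equiv.Perm (Fin n)) : mch τ σ = 0 ↔ Avoids τ (permWord σ) := by
  rw [mch, Finset.card_eq_zero, Finset.filter_eq_empty_iff]
  constructor
  · intro h i hi
    have hi' := (matchAt_iff_headMatch hp τ σ i).2 hi
    exact h (Finset.mem_range.2 (by have := hi'.1; omega)) hi'
  · intro h i _ hi
    exact h i ((matchAt_iff_headMatch hp τ σ i).1 hi)

theorem exists_permWord_map_eq {w : List ℕ} (hw : w.Nodup) :
    ∃ (σ : Equiv.Perm (Fin w.length)) (g : ℕ → ℕ), StrictMono g ∧ (permWord σ).map g = w := by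
  obtain ⟨g, hg, hT⟩ := exists_strictMono_image_range w.toFinset
  have hmem : w ∈ arrangements w.toFinset := mem_arrangements.2 ⟨hw, rfl⟩
  rw [← hT, arrangements_image hg, Finset.mem_image, List.toFinset_card_of_nodup hw] at hmem
  obtain ⟨v, hv, hvw⟩ := hmem
  obtain ⟨σ, rfl⟩ := exists_permWord_eq hv
  exact ⟨σ, g, hg, hvw⟩

theorem MinOverlapping.not_headMatch_drop {p : ℕ} {τ : Equiv.Perm (Fin p)}
    (hτ : MinOverlapping τ) {w : List ℕ} (hw : w.Nodup) (h0 : HeadMatch τ w) {i : ℕ}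
    (hi : 1 ≤ i) (hip : i < p - 1) : ¬ HeadMatch τ (w.drop i) := by
  intro h
  have hex : ∃ i, 1 ≤ i ∧ HeadMatch τ (w.drop i) := ⟨i, hi, h⟩
  obtain ⟨hm1, hm⟩ := Nat.find_spec hex
  have hmin := fun {j : ℕ} (hj : j < Nat.find hex) => Nat.find_min hex hj
  have hmi : Nat.find hex ≤ i := Nat.find_min' hex ⟨hi, h⟩
  generalize Nat.find hex = m at hm1 hm hmin hmi
  have hlen : p + m ≤ w.length := by
    have := hm.1
    rw [List.length_drop] at this
    omega
  have hul : (w.take (p + m)).length = p + m := by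
    rw [List.length_take]
    omega
  obtain ⟨σ, g, hg, hσ⟩ := exists_permWord_map_eq (hw.sublist (List.take_sublist (p + m) w))
  have hmatch : ∀ j, MatchAt τ σ j ↔ p ≤ p + m - j ∧ HeadMatch τ (w.drop j) := by
    intro j
    rw [matchAt_iff_headMatch (by omega), ← headMatch_map τ hg, List.map_drop, hσ,
      List.drop_take, headMatch_take]
  have hmch : mch τ σ = 2 := by
    rw [mch, Finset.card_eq_two]
    refine ⟨0, m, by omega, ?_⟩
    ext j
    simp only [Finset.mem_filter, Finset.mem_range, hmatch, Finset.mem_insert,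
      Finset.mem_singleton, hul]
    constructor
    · rintro ⟨-, h1, h2⟩
      by_contra hne
      exact hmin (j := j) (by omega) ⟨by omega, h2⟩
    · rintro (rfl | rfl)
      · exact ⟨by omega, by omega, by simpa using h0⟩
      · exact ⟨by omega, by omega, hm⟩
  have := hτ.2 ⟨σ, hmch⟩
  omega

theorem HeadMatch.getD_lt_iff {p : ℕ} {τ : Equiv.Perm (Fin p)} {w : List ℕ}
    (h : HeadMatch τ w) {a b : ℕ} (ha : a < p) (hb : b < p) :
    w.getD a 0 < w.getD b 0 ↔ τ ⟨a, ha⟩ < τ ⟨b, hb⟩ :=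
  (h.2 ⟨a, ha⟩ ⟨b, hb⟩).symm

theorem listDes_cons_cons (x y : ℕ) (r : List ℕ) :
    listDes (x :: y :: r) = (if y < x then 1 else 0) + listDes (y :: r) := by
  simp only [listDes, List.length_cons, Nat.add_sub_cancel]
  rw [Finset.sum_range_succ', add_comm]
  rfl

theorem HeadMatch.listDes_eq {p : ℕ} {τ : Equiv.Perm (Fin p)} {w : List ℕ}
    (h : HeadMatch τ w) : listDes w = des τ + listDes (w.drop (p - 1)) := by
  have hp := h.1
  rw [← listDes_permWord τ]
  simp only [listDes, length_permWord, List.length_drop]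
  have hlen : w.length - 1 = p - 1 + (w.length - (p - 1) - 1) := by omega
  rw [hlen, Finset.sum_range_add]
  congr 1
  · refine Finset.sum_congr rfl fun i hi => if_congr ?_ rfl rfl
    rw [Finset.mem_range] at hi
    rw [h.getD_lt_iff (by omega) (by omega), getD_permWord τ (by omega),
      getD_permWord τ (by omega), Fin.val_fin_lt]
  · refine Finset.sum_congr rfl fun i _ => ?_
    rw [getD_drop_eq, getD_drop_eq, add_assoc]

theorem avoids_map {p : ℕ} (τ : Equiv.Perm (Fin p)) {g : ℕ → ℕ} (hg : StrictMono g)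
    (w : List ℕ) : Avoids τ (w.map g) ↔ Avoids τ w := by
  unfold Avoids
  refine forall_congr' fun i => ?_
  rw [← List.map_drop, headMatch_map τ hg]

theorem avoids_cons_iff {p : ℕ} (τ : Equiv.Perm (Fin p)) (x : ℕ) (w : List ℕ) :
    Avoids τ (x :: w) ↔ ¬ HeadMatch τ (x :: w) ∧ Avoids τ w := by
  constructor
  · exact fun h => ⟨h 0, fun i => h (i + 1)⟩
  · rintro ⟨h0, h⟩ (_ | i)
    · exact h0
    · exact h i

theorem MinOverlapping.avoids_drop_iff {p : ℕ} {τ : Equiv.Perm (Fin p)}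
    (hτ : MinOverlapping τ) {w : List ℕ} (hw : w.Nodup) (h0 : HeadMatch τ w) (hp : 2 ≤ p) :
    Avoids τ (w.drop 1) ↔ Avoids τ (w.drop (p - 1)) := by
  unfold Avoids
  simp only [List.drop_drop]
  constructor
  · intro h i
    convert h (p - 2 + i) using 3
    omega
  · intro h i
    by_cases hi : 1 + i < p - 1
    · exact hτ.not_headMatch_drop hw h0 (by omega) hi
    · convert h (i + 1 - (p - 1)) using 3
      omega

section Blocks

variable {K : Type} [Field K] (z : K) {p : ℕ} (τ : Equiv.Perm (Fin p))

/-- The descent weight of a word that avoids `τ`, and zero on all other words. -/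
def avoidWeight (w : List ℕ) : K := if Avoids τ w then z ^ listDes w else 0

/-- The signed weight of all ways to cover a word from left to right by ascents, each of weight
`1 - z`, and by matches of `τ`, each of weight `-z ^ des τ`, where consecutive pieces share one
letter. -/
def blockWeight : List ℕ → K
  | [] => 0
  | [_] => 1
  | x :: y :: r => (if x < y then (1 - z) * blockWeight (y :: r) else 0) -
      if HeadMatch τ (x :: y :: r) then z ^ des τ * blockWeight ((y :: r).drop (p - 2)) else 0
  termination_by w => w.length

theorem orderInvariant_avoidWeight : OrderInvariant (avoidWeight z τ) := by
  intro g hg w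
  have hdes : listDes (w.map g) = listDes w := by
    unfold listDes
    rw [List.length_map]
    refine Finset.sum_congr rfl fun i hi => if_congr ?_ rfl rfl
    rw [Finset.mem_range] at hi
    exact getD_map_lt hg (by omega) (by omega)
  rw [avoidWeight, avoidWeight, hdes, if_congr (avoids_map τ hg w) rfl rfl]

theorem orderInvariant_blockWeight : OrderInvariant (blockWeight z τ) := by
  intro g hg w
  induction w using blockWeight.induct (p := p) with
  | case1 => rfl
  | case2 x => simp [blockWeight]
  | case3 x y r ih1 ih2 =>
    have h := headMatch_map τ hg (x :: y :: r)
    simp only [List.map_cons] at h ih1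
    rw [List.map_drop, List.map_cons] at ih2
    simp only [List.map_cons, blockWeight, hg.lt_iff_lt, h, ih1, ih2]

variable {z τ}

theorem lt_of_blockWeight_ne_zero (hp : 3 ≤ p) (hfirst : τ ⟨0, by omega⟩ = ⟨0, by omega⟩)
    {w : List ℕ} (hw : blockWeight z τ w ≠ 0) {i : ℕ} (hi : 0 < i) (hil : i < w.length) :
    w.getD 0 0 < w.getD i 0 := by
  induction w using blockWeight.induct (p := p) generalizing i with
  | case1 => simp at hil
  | case2 x => simp at hil; omega
  | case3 x y r ih1 ih2 =>
    rw [blockWeight] at hw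
    by_cases hm : HeadMatch τ (x :: y :: r) ∧ blockWeight z τ ((y :: r).drop (p - 2)) ≠ 0
    · have hlt : ∀ j, 0 < j → j < p → (x :: y :: r).getD 0 0 < (x :: y :: r).getD j 0 := by
        intro j hj hjp
        rw [hm.1.getD_lt_iff (by omega) hjp, hfirst, Fin.lt_def]
        have hne : τ ⟨j, hjp⟩ ≠ τ ⟨0, by omega⟩ := fun h => by
          have := Fin.mk.inj_iff.1 (τ.injective h)
          omega
        rw [hfirst, Ne, Fin.ext_iff] at hne
        exact Nat.pos_of_ne_zero hne
      by_cases hip : i < p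
      · exact hlt i hi hip
      · refine (hlt (p - 1) (by omega) (by omega)).trans ?_
        have hlen := hm.1.1
        simp only [List.length_cons] at hlen hil
        have := ih2 hm.2 (i := i - (p - 1)) (by omega) (by simp; omega)
        have hs : ∀ j, (y :: r).getD j 0 = (x :: y :: r).getD (j + 1) 0 := fun _ => rfl
        rw [getD_drop_eq, getD_drop_eq, hs, hs] at this
        rwa [show p - 2 + 0 + 1 = p - 1 by omega,
          show p - 2 + (i - (p - 1)) + 1 = i by omega] at this
    · have hz : (if HeadMatch τ (x :: y :: r) then
          z ^ des τ * blockWeight z τ ((y :: r).drop (p - 2)) else 0) = 0 := by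
        split_ifs with h
        · rw [not_not.1 fun h' => hm ⟨h, h'⟩, mul_zero]
        · rfl
      rw [hz, sub_zero] at hw
      have hxy : x < y := by
        by_contra h
        exact hw (if_neg h)
      rw [if_pos hxy] at hw
      obtain ⟨i, rfl⟩ : ∃ j, i = j + 1 := ⟨i - 1, by omega⟩
      rcases Nat.eq_zero_or_pos i with rfl | h0
      · simpa using hxy
      · have := ih1 (right_ne_zero_of_mul hw) h0 (by simpa using hil)
        simp only [List.getD_cons_succ, List.getD_cons_zero] at this ⊢
        exact hxy.trans this

variable (z) in
theorem avoidWeight_cons_cons (hp : 3 ≤ p) (hτ : MinOverlapping τ) {x y : ℕ} {r : List ℕ}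
    (hw : (x :: y :: r).Nodup) :
    avoidWeight z τ (x :: y :: r) = z * avoidWeight z τ (y :: r) +
      (if x < y then (1 - z) * avoidWeight z τ (y :: r) else 0) -
      if HeadMatch τ (x :: y :: r) then z ^ des τ * avoidWeight z τ ((y :: r).drop (p - 2))
        else 0 := by
  have hne : x ≠ y := fun h => by simp [h] at hw
  have hstep : z * avoidWeight z τ (y :: r) +
      (if x < y then (1 - z) * avoidWeight z τ (y :: r) else 0) =
      if Avoids τ (y :: r) then z ^ listDes (x :: y :: r) else 0 := by
    rw [avoidWeight, listDes_cons_cons]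
    by_cases ha : Avoids τ (y :: r)
    · simp only [if_pos ha]
      rcases hne.lt_or_gt with h | h
      · rw [if_pos h, if_neg h.not_gt, zero_add]
        ring
      · rw [if_neg h.not_gt, if_pos h, pow_add]
        ring
    · simp [ha]
  rw [hstep]
  by_cases hm : HeadMatch τ (x :: y :: r)
  · have hdrop : (x :: y :: r).drop (p - 1) = (y :: r).drop (p - 2) := by
      rw [show p - 1 = p - 2 + 1 by omega, List.drop_succ_cons]
    have h1 := hτ.avoids_drop_iff hw hm (by omega)
    rw [hdrop, List.drop_one, List.tail_cons] at h1
    rw [if_pos hm, avoidWeight, avoidWeight, avoids_cons_iff, if_neg (fun h => h.1 hm),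
      hm.listDes_eq, hdrop, pow_add]
    by_cases ha : Avoids τ (y :: r)
    · rw [if_pos ha, if_pos (h1.1 ha), sub_self]
    · rw [if_neg ha, if_neg (fun h => ha (h1.2 h))]
      ring
  · rw [if_neg hm, sub_zero, avoidWeight, avoids_cons_iff]
    simp [hm]

theorem blockWeight_take_succ (x : ℕ) (w : List ℕ) {k : ℕ} (hk : 1 ≤ k)
    (hkw : k < w.length) :
    blockWeight z τ ((x :: w).take (k + 1)) =
      (if x < w.getD 0 0 then (1 - z) * blockWeight z τ (w.take k) else 0) -
      if HeadMatch τ (x :: w) ∧ p ≤ k + 1 then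
        z ^ des τ * blockWeight z τ ((w.drop (p - 2)).take (k - (p - 2))) else 0 := by
  obtain ⟨k, rfl⟩ : ∃ j, k = j + 1 := ⟨k - 1, by omega⟩
  have hm := headMatch_take τ (x :: w) (k + 1 + 1)
  cases w with
  | nil => simp at hkw
  | cons y r =>
    rw [List.take_succ_cons] at hm
    rw [List.take_succ_cons, List.take_succ_cons, blockWeight, ← List.take_succ_cons, List.drop_take, if_congr (hm.trans and_comm) rfl rfl,
      List.getD_cons_zero]

theorem avoidWeight_eq_sum (hp : 3 ≤ p) (hτ : MinOverlapping τ) (w : List ℕ) (hw : w.Nodup)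
    (hne : w ≠ []) :
    avoidWeight z τ w = blockWeight z τ w + ∑ k ∈ Finset.Ico 1 w.length,
      z * (blockWeight z τ (w.take k) * avoidWeight z τ (w.drop k)) := by
  induction w using blockWeight.induct (p := p) with
  | case1 => exact absurd rfl hne
  | case2 x =>
    have : Avoids τ [x] := fun i hi => by
      have := hi.1
      rw [List.length_drop, List.length_singleton] at this
      omega
    simp [avoidWeight, blockWeight, this, listDes]
  | case3 x y r ih1 ih2 =>
    have hw' : (y :: r).Nodup := (List.nodup_cons.1 hw).2
    have ih1 := ih1 hw' (by simp)
    have ih2 := ih2 (hw'.sublist (List.drop_sublist _ _))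
    have hbw := blockWeight.eq_3 z τ x y r
    have htake := fun {k} => blockWeight_take_succ (z := z) (τ := τ) x (y :: r) (k := k)
    rw [avoidWeight_cons_cons z hp hτ hw, hbw, List.length_cons (a := x)]
    generalize hv : y :: r = v at *
    have hy : v.getD 0 0 = y := by rw [← hv]; rfl
    have hvl : 1 ≤ v.length := by rw [← hv]; simp
    rw [hy] at htake
    rw [Finset.sum_eq_sum_Ico_succ_bot (by omega), List.take_one, List.head?_cons,
      List.drop_one, List.tail_cons, ← Finset.sum_Ico_add' _ 1 v.length 1,
      Finset.sum_congr rfl fun k hk => by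
        rw [htake (Finset.mem_Ico.1 hk).1 (Finset.mem_Ico.1 hk).2, List.drop_succ_cons]]
    have hasc : ∑ k ∈ Finset.Ico 1 v.length, z * ((if x < y then
        (1 - z) * blockWeight z τ (v.take k) else 0) * avoidWeight z τ (v.drop k)) =
        if x < y then (1 - z) * (avoidWeight z τ v - blockWeight z τ v) else 0 := by
      split_ifs
      · rw [ih1, add_sub_cancel_left, Finset.mul_sum]
        exact Finset.sum_congr rfl fun k _ => by ring
      · simp
    have hmat : ∑ k ∈ Finset.Ico 1 v.length, z * ((if HeadMatch τ (x :: v) ∧ p ≤ k + 1 then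
        z ^ des τ * blockWeight z τ ((v.drop (p - 2)).take (k - (p - 2))) else 0) *
          avoidWeight z τ (v.drop k)) =
        if HeadMatch τ (x :: v) then z ^ des τ * (avoidWeight z τ (v.drop (p - 2)) -
          blockWeight z τ (v.drop (p - 2))) else 0 := by
      by_cases hm : HeadMatch τ (x :: v)
      · have hlen := hm.1
        rw [List.length_cons] at hlen
        simp only [hm, true_and, if_true]
        have hne' : v.drop (p - 2) ≠ [] := by
          rw [Ne, List.drop_eq_nil_iff]
          omega
        rw [ih2 hne', add_sub_cancel_left, Finset.mul_sum, List.length_drop,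
          ← Finset.sum_Ico_consecutive _ (show 1 ≤ p - 1 by omega) (show p - 1 ≤ v.length by omega),
          Finset.sum_eq_zero, zero_add]
        · rw [show p - 1 = 1 + (p - 2) by omega,
            show v.length = v.length - (p - 2) + (p - 2) by omega, ← Finset.sum_Ico_add']
          refine Finset.sum_congr (by congr 1; omega) fun k hk => ?_
          rw [Finset.mem_Ico] at hk
          rw [if_pos (by omega), Nat.add_sub_cancel, List.drop_drop, add_comm k]
          ring
        · intro k hk
          rw [Finset.mem_Ico] at hk
          rw [if_neg (by omega)]
          ring
      · simp [hm]
    simp only [sub_mul _ _ (avoidWeight _ _ _), mul_sub z, Finset.sum_sub_distrib, hasc, hmat]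
    simp only [Option.toList, blockWeight]
    split_ifs <;> ring

end Blocks

theorem eq_of_headMatch_permWord {p : ℕ} {τ σ : Equiv.Perm (Fin p)}
    (h : HeadMatch τ (permWord σ)) : σ = τ := by
  have hlt : ∀ a b, τ a < τ b ↔ σ a < σ b := by
    intro a b
    rw [h.2, getD_permWord σ a.2, getD_permWord σ b.2, Fin.val_fin_lt]
  have hmono : StrictMono fun a => σ (τ.symm a) := by
    intro a b hab
    rw [← hlt]
    simpa using hab
  have hid := (StrictMono.range_inj hmono strictMono_id).1 (by
    rw [Set.range_id]
    exact (τ.symm.trans σ).surjective.range_eq)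
  ext a
  have := congrFun hid (τ a)
  simp only [Equiv.symm_apply_apply, id] at this
  rw [this]

theorem headMatch_permWord {p : ℕ} (τ : Equiv.Perm (Fin p)) : HeadMatch τ (permWord τ) := by
  refine ⟨(length_permWord τ).ge, fun a b => ?_⟩
  rw [getD_permWord τ a.2, getD_permWord τ b.2, Fin.val_fin_lt]

theorem headMatch_iff_eq_map_permWord {p : ℕ} (τ : Equiv.Perm (Fin p)) {g : ℕ → ℕ}
    (hg : StrictMono g) {u : List ℕ} (hu : u ∈ arrangements ((Finset.range p).image g)) :
    HeadMatch τ u ↔ u = (permWord τ).map g := by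
  rw [arrangements_image hg, Finset.mem_image] at hu
  obtain ⟨v, hv, rfl⟩ := hu
  obtain ⟨σ, rfl⟩ := exists_permWord_eq hv
  rw [headMatch_map τ hg]
  constructor
  · intro h
    rw [eq_of_headMatch_permWord h]
  · intro h
    rw [List.map_injective_iff.2 hg.injective h]
    exact headMatch_permWord τ

theorem card_filter_lt_of_headMatch {p : ℕ} {τ : Equiv.Perm (Fin p)} {T : Finset ℕ}
    {u : List ℕ} (hT : T.card = p) (hu : u ∈ arrangements T) (h : HeadMatch τ u) (i : Fin p) :
    (T.filter (· < u.getD i 0)).card = τ i := by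
  obtain ⟨g, hg, hgT⟩ := exists_strictMono_image_range T
  rw [hT] at hgT
  subst hgT
  rw [headMatch_iff_eq_map_permWord τ hg hu] at h
  have hi : u.getD i 0 = g (τ i) := by
    have hl := i.2
    have := getD_permWord τ hl
    simp only [List.getD, length_permWord, hl, getElem?_pos, Option.getD_some] at this
    simp [h, List.getD, length_permWord, this]
  have himg : ((Finset.range p).image g).filter (· < u.getD i 0) =
      (Finset.range (τ i)).image g := by
    have hτi := (τ i).2
    ext x
    simp only [Finset.mem_filter, Finset.mem_image, Finset.mem_range, hi]
    constructor
    · rintro ⟨⟨y, hy, rfl⟩, hlt⟩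
      exact ⟨y, hg.lt_iff_lt.1 hlt, rfl⟩
    · rintro ⟨y, hy, rfl⟩
      exact ⟨⟨y, by omega, rfl⟩, hg hy⟩
  rw [himg, Finset.card_image_of_injective _ hg.injective, Finset.card_range]

section Recursion

variable {K : Type} [Field K] {q z : K} {p : ℕ} {τ : Equiv.Perm (Fin p)}

theorem lt_of_mem_tail_of_blockWeight_ne_zero (hp : 3 ≤ p)
    (hfirst : τ ⟨0, by omega⟩ = ⟨0, by omega⟩) {m : ℕ} {r : List ℕ}
    (hw : blockWeight z τ (m :: r) ≠ 0) {y : ℕ} (hy : y ∈ r) : m < y := by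
  obtain ⟨i, hi, rfl⟩ := List.getElem_of_mem hy
  have := lt_of_blockWeight_ne_zero hp hfirst hw (i := i + 1) (by omega) (by simpa using hi)
  simpa [List.getD, hi] using this

theorem blockWeight_of_two_le_length (hp : 2 ≤ p) {w : List ℕ} (hw : 2 ≤ w.length) :
    blockWeight z τ w = (1 - z) *
        (if w.getD 0 0 < w.getD 1 0 then blockWeight z τ (w.drop 1) else 0) -
      z ^ des τ * if HeadMatch τ w then blockWeight z τ (w.drop (p - 1)) else 0 := by
  obtain ⟨p, rfl⟩ : ∃ k, p = k + 2 := ⟨p - 2, by omega⟩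
  match w, hw with
  | x :: y :: r, _ =>
    rw [blockWeight]
    simp

variable (q) in
theorem sum_ascent_blockWeight (hp : 3 ≤ p) (hfirst : τ ⟨0, by omega⟩ = ⟨0, by omega⟩) {n : ℕ}
    (hn : 2 ≤ n) :
    ∑ w ∈ arrangements (Finset.range n), q ^ listInv w *
        (if w.getD 0 0 < w.getD 1 0 then blockWeight z τ (w.drop 1) else 0) =
      invSum q (blockWeight z τ) (n - 1) := by
  rw [sum_arrangements_split (k := 1) (by simp; omega), Finset.powersetCard_one, Finset.sum_map]
  have h0 : (0 : ℕ) ∈ Finset.range n := by simp; omega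
  rw [Finset.sum_eq_single_of_mem 0 h0]
  · have hcard : (Finset.range n \ {0}).card = n - 1 := by
      rw [Finset.card_sdiff_of_subset (by simpa using h0)]
      simp
    simp only [Function.Embedding.coeFn_mk, arrangements_singleton, Finset.sum_singleton]
    rw [← hcard, ← sum_arrangements_eq_invSum q (orderInvariant_blockWeight z τ)]
    refine Finset.sum_congr rfl fun v hv => ?_
    have hl := length_of_mem_arrangements hv
    match v, hl with
    | [], hl => simp at hl; omega
    | y :: r, _ =>
      have hy := (mem_of_mem_arrangements hv (x := y)).1 (by simp)
      simp only [Finset.mem_sdiff, Finset.mem_singleton] at hy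
      have : 0 < y := Nat.pos_of_ne_zero hy.2
      simp [listInv, this]
  · intro x hx hx0
    simp only [Function.Embedding.coeFn_mk, arrangements_singleton, Finset.sum_singleton]
    refine Finset.sum_eq_zero fun v hv => mul_eq_zero_of_right _ ?_
    by_contra hne
    obtain ⟨hlt, hbw⟩ := ite_ne_right_iff.1 hne
    have h0v := (mem_of_mem_arrangements hv (x := 0)).2 (by simp [h0, Ne.symm hx0])
    match v with
    | [] => simp at h0v
    | y :: r =>
      simp only [List.singleton_append, List.getD_cons_zero, List.getD_cons_succ, List.drop_one,
        List.tail_cons] at hlt hbw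
      rcases List.mem_cons.1 h0v with h | h
      · omega
      · have := lt_of_mem_tail_of_blockWeight_ne_zero hp hfirst hbw h
        omega

theorem headMatch_append_cons_iff {u : List ℕ} (hu : u.length + 1 = p) (m : ℕ) (r : List ℕ) :
    HeadMatch τ (u ++ m :: r) ↔ HeadMatch τ (u ++ [m]) := by
  have := headMatch_take τ (u ++ m :: r) p
  rw [List.take_append, List.take_of_length_le (by omega), show p - u.length = 1 by omega,
    List.take_one, List.head?_cons] at this
  exact (this.trans (and_iff_right le_rfl)).symm

theorem eq_of_headMatch_append (hp : 3 ≤ p) {s : ℕ}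
    (hfirst : τ ⟨0, by omega⟩ = ⟨0, by omega⟩) (hs : 1 ≤ s) (hsp : s ≤ p)
    (hlast : τ ⟨p - 1, by omega⟩ = ⟨s - 1, by omega⟩) {n : ℕ} {T : Finset ℕ}
    (hTc : T.card = p - 1) {u r : List ℕ} {m : ℕ} (hu : u ∈ arrangements T)
    (hv : m :: r ∈ arrangements (Finset.range n \ T)) (hm : HeadMatch τ (u ++ m :: r))
    (hf : blockWeight z τ (m :: r) ≠ 0) :
    m = s - 1 ∧ T ∩ Finset.range s = Finset.range (s - 1) := by
  have hmS : m ∈ Finset.range n \ T := (mem_of_mem_arrangements hv).1 (by simp)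
  rw [Finset.mem_sdiff, Finset.mem_range] at hmS
  have hul : u.length = p - 1 := by rw [length_of_mem_arrangements hu, hTc]
  have hbelow : ∀ x < m, x ∈ T := by
    intro x hx
    by_contra hxT
    have := (mem_of_mem_arrangements hv (x := x)).2 (by simp [hxT]; omega)
    rcases List.mem_cons.1 this with h | h
    · omega
    · have := lt_of_mem_tail_of_blockWeight_ne_zero hp hfirst hf h
      omega
  have hm' := (headMatch_append_cons_iff (by omega) m r).1 hm
  have hmem : u ++ [m] ∈ arrangements (T ∪ {m}) :=
    append_mem_arrangements (by simpa using hmS.2) hu (by simp [arrangements_singleton])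
  have hcount := card_filter_lt_of_headMatch (by
    rw [Finset.card_union_of_disjoint (by simpa using hmS.2), hTc, Finset.card_singleton]
    omega) hmem hm' ⟨p - 1, by omega⟩
  have hget : (u ++ [m]).getD (p - 1) 0 = m := by simp [List.getD, ← hul]
  have hrange : (T ∪ {m}).filter (· < m) = Finset.range m := by
    ext x
    simp only [Finset.mem_filter, Finset.mem_union, Finset.mem_singleton, Finset.mem_range]
    exact ⟨And.right, fun h => ⟨Or.inl (hbelow x h), h⟩⟩
  simp only [hlast, hget] at hcount
  rw [hrange, Finset.card_range] at hcount
  refine ⟨hcount, ?_⟩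
  ext x
  simp only [Finset.mem_inter, Finset.mem_range]
  constructor
  · rintro ⟨hxT, hx⟩
    have : x ≠ m := fun h => hmS.2 (h ▸ hxT)
    omega
  · intro hx
    exact ⟨hbelow x (by omega), by omega⟩

theorem head_eq_of_blockWeight_ne_zero (hp : 3 ≤ p) (hfirst : τ ⟨0, by omega⟩ = ⟨0, by omega⟩)
    {s n : ℕ} (hs : 1 ≤ s) (hsn : s ≤ n) {T : Finset ℕ}
    (hTs : T ∩ Finset.range s = Finset.range (s - 1)) {m : ℕ} {r : List ℕ}
    (hv : m :: r ∈ arrangements (Finset.range n \ T)) (hf : blockWeight z τ (m :: r) ≠ 0) :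
    m = s - 1 := by
  have hmem : ∀ x < s, x ∈ T ↔ x < s - 1 := by
    intro x hx
    have := congrArg (x ∈ ·) hTs
    simpa [hx] using this
  have hm := (mem_of_mem_arrangements hv (x := m)).1 (by simp)
  rw [Finset.mem_sdiff] at hm
  have hs' := (mem_of_mem_arrangements hv (x := s - 1)).2 (by
    rw [Finset.mem_sdiff, hmem _ (by omega), Finset.mem_range]
    omega)
  rcases List.mem_cons.1 hs' with h | h
  · exact h.symm
  · have hlt := lt_of_mem_tail_of_blockWeight_ne_zero hp hfirst hf h
    exact absurd ((hmem m (by omega)).2 hlt) hm.2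

theorem exists_unique_headMatch_append {s : ℕ} (hs : 1 ≤ s) (hsp : s ≤ p)
    (hlast : τ ⟨p - 1, by omega⟩ = ⟨s - 1, by omega⟩) {T : Finset ℕ} (hTc : T.card = p - 1)
    (hTs : T ∩ Finset.range s = Finset.range (s - 1)) :
    ∃ u₀ ∈ arrangements T, listInv u₀ + (p - s) = inv τ ∧
      ∀ u ∈ arrangements T, HeadMatch τ (u ++ [s - 1]) ↔ u = u₀ := by
  have hp1 : p - 1 < p := by omega
  have hmT : s - 1 ∉ T := by
    intro h
    have : s - 1 ∈ T ∩ Finset.range s := by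
      simp only [Finset.mem_inter, Finset.mem_range]
      exact ⟨h, by omega⟩
    rw [hTs] at this
    simp at this
  have hsub : ∀ x < s, x ∈ T ∪ {s - 1} := by
    intro x hx
    by_cases hxs : x = s - 1
    · simp [hxs]
    · have : x ∈ T ∩ Finset.range s := by
        rw [hTs, Finset.mem_range]
        omega
      exact Finset.mem_union_left _ (Finset.mem_inter.1 this).1
  have hcard : (T ∪ {s - 1}).card = p := by
    rw [Finset.card_union_of_disjoint (by simpa using hmT), hTc, Finset.card_singleton]
    omega
  obtain ⟨g, hg, hT⟩ := exists_strictMono_image_range (T ∪ {s - 1})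
  rw [hcard] at hT
  have hw : (permWord τ).map g ∈ arrangements (T ∪ {s - 1}) := by
    rw [← hT, arrangements_image hg]
    exact Finset.mem_image_of_mem _ (permWord_mem_arrangements τ)
  have hwm : HeadMatch τ ((permWord τ).map g) := (headMatch_map τ hg _).2 (headMatch_permWord τ)
  have hwl : ((permWord τ).map g).length = p := by rw [List.length_map, length_permWord]
  have hiff : ∀ u ∈ arrangements (T ∪ {s - 1}), HeadMatch τ u ↔ u = (permWord τ).map g := by
    rw [← hT]
    exact fun u hu => headMatch_iff_eq_map_permWord τ hg hu
  have hinv : listInv ((permWord τ).map g) = inv τ := by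
    rw [listInv_map hg, listInv_permWord]
  have hcount := card_filter_lt_of_headMatch hcard hw hwm ⟨p - 1, hp1⟩
  generalize (permWord τ).map g = w at *
  obtain ⟨u₀, m, rfl⟩ : ∃ u m, w = u ++ [m] := by
    rcases List.eq_nil_or_concat' w with rfl | h
    · simp at hwl
      omega
    · exact h
  have hul : u₀.length = p - 1 := by
    rw [List.length_append, List.length_singleton] at hwl
    omega
  have hget : (u₀ ++ [m]).getD (p - 1) 0 = m := by simp [List.getD, ← hul]
  simp only [hlast, hget] at hcount
  have hm : m = s - 1 := by
    by_cases hms : m < s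
    · have : (T ∪ {s - 1}).filter (· < m) = Finset.range m := by
        ext x
        simp only [Finset.mem_filter, Finset.mem_range]
        exact ⟨And.right, fun h => ⟨hsub x (by omega), h⟩⟩
      rwa [this, Finset.card_range] at hcount
    · have : Finset.range s ⊆ (T ∪ {s - 1}).filter (· < m) := by
        intro x hx
        rw [Finset.mem_range] at hx
        exact Finset.mem_filter.2 ⟨hsub x hx, by omega⟩
      have := Finset.card_le_card this
      rw [Finset.card_range] at this
      omega
  subst hm
  have hu₀ : u₀ ∈ arrangements T := by
    obtain ⟨hn, hset⟩ := mem_arrangements.1 hw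
    have hn' := List.nodup_append'.1 hn
    refine mem_arrangements.2 ⟨hn'.1, ?_⟩
    have hnot : s - 1 ∉ u₀ := fun h => hn'.2.2 h (by simp)
    ext x
    have hx := congrArg (x ∈ ·) hset
    simp only [List.toFinset_append, Finset.mem_union, List.mem_toFinset, List.mem_singleton,
      Finset.mem_singleton, eq_iff_iff] at hx
    by_cases hxs : x = s - 1
    · subst hxs
      simp [hnot, hmT]
    · simpa [hxs] using hx
  refine ⟨u₀, hu₀, ?_, ?_⟩
  · rw [← hinv, listInv_append_of_mem hu₀ (U := {s - 1}) (by simp [arrangements_singleton])]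
    simp only [listInv, List.countP_nil, add_zero]
    congr 1
    have hsum : ∀ x ∈ T, (({s - 1} : Finset ℕ).filter (· < x)).card =
        if x ∉ Finset.range s then 1 else 0 := by
      intro x hx
      have : x ≠ s - 1 := fun h => hmT (h ▸ hx)
      rw [Finset.filter_singleton, apply_ite Finset.card, Finset.card_singleton,
        Finset.card_empty]
      refine if_congr ?_ rfl rfl
      rw [Finset.mem_range]
      omega
    rw [crossInv, Finset.sum_congr rfl hsum, ← Finset.card_filter, ← Finset.sdiff_eq_filter,
      Finset.card_sdiff, Finset.inter_comm, hTs, Finset.card_range, hTc]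
    omega
  · intro u hu
    rw [hiff _ (append_mem_arrangements (by simpa using hmT) hu (by simp [arrangements_singleton]))]
    exact List.append_left_inj _

theorem crossInv_compl_range {s n : ℕ} (hs : 1 ≤ s) (hsn : s ≤ n) {T : Finset ℕ}
    (hTs : T ∩ Finset.range s = Finset.range (s - 1)) :
    crossInv T (Finset.range n \ T) = (T \ Finset.range s).card +
      crossInv (T \ Finset.range s) (Finset.Ico s n \ (T \ Finset.range s)) := by
  have hmem : ∀ x < s, x ∈ T ↔ x < s - 1 := by
    intro x hx
    have := congrArg (x ∈ ·) hTs
    simpa [hx] using this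
  have hT0 : ∑ x ∈ T ∩ Finset.range s, ((Finset.range n \ T).filter (· < x)).card = 0 := by
    rw [hTs]
    refine Finset.sum_eq_zero fun x hx => ?_
    rw [Finset.mem_range] at hx
    rw [Finset.card_eq_zero, Finset.filter_eq_empty_iff]
    intro y hy hyx
    rw [Finset.mem_sdiff] at hy
    exact hy.2 ((hmem y (by omega)).2 (by omega))
  rw [crossInv, ← Finset.sum_inter_add_sum_sdiff T (Finset.range s), hT0, zero_add, crossInv,
    Finset.card_eq_sum_ones, ← Finset.sum_add_distrib]
  refine Finset.sum_congr rfl fun x hx => ?_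
  simp only [Finset.mem_sdiff, Finset.mem_range] at hx
  have hins : (Finset.range n \ T).filter (· < x) = insert (s - 1)
      ((Finset.Ico s n \ (T \ Finset.range s)).filter (· < x)) := by
    ext y
    simp only [Finset.mem_filter, Finset.mem_sdiff, Finset.mem_range, Finset.mem_insert,
      Finset.mem_Ico]
    have := hmem y
    by_cases hys : y < s
    · rw [this hys]
      omega
    · have hys' : y ≠ s - 1 := by omega
      have hsy : s ≤ y := by omega
      simp only [hys, hys', hsy, not_false_eq_true, and_true, true_and, false_or]
  rw [hins, Finset.card_insert_of_notMem (by simp; omega), add_comm]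

theorem sum_powersetCard_filter_inter_range {M : Type} [AddCommMonoid M] {s n p : ℕ}
    (hs : 1 ≤ s) (hsp : s ≤ p) (hpn : p ≤ n) (X : Finset ℕ → M) :
    ∑ T ∈ (Finset.range n).powersetCard (p - 1),
      (if T ∩ Finset.range s = Finset.range (s - 1) then X (T \ Finset.range s) else 0) =
    ∑ T ∈ (Finset.Ico s n).powersetCard (p - s), X T := by
  rw [← Finset.sum_filter]
  have hinv : ∀ T ∈ (Finset.Ico s n).powersetCard (p - s),
      (T ∪ Finset.range (s - 1)) \ Finset.range s = T := by
    intro T hT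
    have hT := (Finset.mem_powersetCard.1 hT).1
    ext x
    have := @hT x
    simp only [Finset.mem_Ico] at this
    simp only [Finset.mem_sdiff, Finset.mem_union, Finset.mem_range]
    constructor
    · rintro ⟨h | h, h'⟩
      · exact h
      · omega
    · intro h
      exact ⟨Or.inl h, by have := this h; omega⟩
  refine Finset.sum_bij' (fun T _ => T \ Finset.range s) (fun T _ => T ∪ Finset.range (s - 1))
    ?_ ?_ ?_ ?_ ?_
  · intro T hT
    obtain ⟨hT, hTs⟩ := Finset.mem_filter.1 hT
    obtain ⟨hTn, hTc⟩ := Finset.mem_powersetCard.1 hT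
    refine Finset.mem_powersetCard.2 ⟨fun x hx => ?_, ?_⟩
    · rw [Finset.mem_sdiff, Finset.mem_range] at hx
      have := Finset.mem_range.1 (hTn hx.1)
      rw [Finset.mem_Ico]
      omega
    · rw [Finset.card_sdiff, Finset.inter_comm, hTs, hTc, Finset.card_range]
      omega
  · intro T hT
    have hi := hinv T hT
    obtain ⟨hTn, hTc⟩ := Finset.mem_powersetCard.1 hT
    have hge : ∀ x ∈ T, s ≤ x ∧ x < n := fun x hx => Finset.mem_Ico.1 (hTn hx)
    refine Finset.mem_filter.2 ⟨Finset.mem_powersetCard.2 ⟨fun x hx => ?_, ?_⟩, ?_⟩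
    · rw [Finset.mem_union, Finset.mem_range] at hx
      rw [Finset.mem_range]
      rcases hx with h | h
      · exact (hge x h).2
      · omega
    · rw [Finset.card_union_of_disjoint, hTc, Finset.card_range]
      · omega
      · rw [Finset.disjoint_left]
        intro x hx hx'
        have := hge x hx
        rw [Finset.mem_range] at hx'
        omega
    · ext x
      have := hge x
      simp only [Finset.mem_inter, Finset.mem_union, Finset.mem_range]
      constructor
      · rintro ⟨h | h, h'⟩
        · have := this h
          omega
        · exact h
      · intro h
        exact ⟨Or.inr h, by omega⟩
  · intro T hT
    obtain ⟨hT, hTs⟩ := Finset.mem_filter.1 hT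
    rw [← hTs, Finset.sdiff_union_inter]
  · exact hinv
  · exact fun _ _ => rfl

variable (q) in
theorem sum_match_blockWeight (hp : 3 ≤ p) (hfirst : τ ⟨0, by omega⟩ = ⟨0, by omega⟩) {s : ℕ}
    (hs : 1 ≤ s) (hsp : s ≤ p) (hlast : τ ⟨p - 1, by omega⟩ = ⟨s - 1, by omega⟩) {n : ℕ}
    (hpn : p ≤ n) :
    ∑ w ∈ arrangements (Finset.range n), q ^ listInv w *
        (if HeadMatch τ w then blockWeight z τ (w.drop (p - 1)) else 0) =
      q ^ inv τ * gaussSum q (Finset.Ico s n) (p - s) *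
        invSum q (blockWeight z τ) (n - (p - 1)) := by
  rw [sum_arrangements_split (k := p - 1) (by simp; omega), gaussSum, Finset.mul_sum,
    Finset.sum_mul, ← sum_powersetCard_filter_inter_range hs hsp hpn]
  refine Finset.sum_congr rfl fun T hT => ?_
  obtain ⟨hTn, hTc⟩ := Finset.mem_powersetCard.1 hT
  have hcard : (Finset.range n \ T).card = n - (p - 1) := by
    rw [Finset.card_sdiff_of_subset hTn, hTc, Finset.card_range]
  have hdrop : ∀ u ∈ arrangements T, ∀ v, (u ++ v).drop (p - 1) = v := fun u hu v =>
    List.drop_left' (by rw [length_of_mem_arrangements hu, hTc])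
  have hcons : ∀ v ∈ arrangements (Finset.range n \ T), ∃ m r, v = m :: r := by
    intro v hv
    have hl := length_of_mem_arrangements hv
    exact List.exists_cons_of_length_pos (by omega)
  split_ifs with hTs
  · obtain ⟨u₀, hu₀, hinv, huniq⟩ := exists_unique_headMatch_append hs hsp hlast hTc hTs
    have hmatch : ∀ u ∈ arrangements T, ∀ v ∈ arrangements (Finset.range n \ T),
        blockWeight z τ v ≠ 0 → (HeadMatch τ (u ++ v) ↔ u = u₀) := by
      intro u hu v hv hf
      obtain ⟨m, r, rfl⟩ := hcons v hv
      have hul := length_of_mem_arrangements hu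
      rw [headMatch_append_cons_iff (by omega),
        head_eq_of_blockWeight_ne_zero hp hfirst hs (by omega) hTs hv hf, huniq u hu]
    have hTd : (T \ Finset.range s).card = p - s := by
      rw [Finset.card_sdiff, Finset.inter_comm, hTs, hTc, Finset.card_range]
      omega
    rw [← hcard, ← sum_arrangements_eq_invSum q (orderInvariant_blockWeight z τ)]
    rw [Finset.sum_eq_single_of_mem u₀ hu₀]
    · rw [Finset.mul_sum]
      refine Finset.sum_congr rfl fun v hv => ?_
      rw [hdrop u₀ hu₀]
      by_cases hf : blockWeight z τ v = 0
      · simp [hf]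
      · rw [if_pos ((hmatch u₀ hu₀ v hv hf).2 rfl), listInv_append_of_mem hu₀ hv,
          crossInv_compl_range hs (by omega) hTs, hTd, ← hinv]
        ring
    · intro u hu hne
      refine Finset.sum_eq_zero fun v hv => mul_eq_zero_of_right _ ?_
      by_contra h
      obtain ⟨hm, hf⟩ := ite_ne_right_iff.1 h
      rw [hdrop u hu] at hf
      exact hne ((hmatch u hu v hv hf).1 hm)
  · refine Finset.sum_eq_zero fun u hu => Finset.sum_eq_zero fun v hv =>
      mul_eq_zero_of_right _ ?_
    by_contra h
    obtain ⟨hm, hf⟩ := ite_ne_right_iff.1 h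
    rw [hdrop u hu] at hf
    obtain ⟨m, r, rfl⟩ := hcons v hv
    exact hTs (eq_of_headMatch_append hp hfirst hs hsp hlast hTc hu hv hm hf).2

end Recursion

section Main

variable {K : Type} [Field K] {q z : K} {p : ℕ} {τ : Equiv.Perm (Fin p)}

theorem invSum_blockWeight_recursion (hq : ∀ n, qFact q n ≠ 0) (hp : 3 ≤ p)
    (hfirst : τ ⟨0, by omega⟩ = ⟨0, by omega⟩) {s : ℕ} (hs : 1 ≤ s) (hsp : s < p)
    (hlast : τ ⟨p - 1, by omega⟩ = ⟨s - 1, by omega⟩) {n : ℕ} (hn : 2 ≤ n) :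
    invSum q (blockWeight z τ) n = (1 - z) * invSum q (blockWeight z τ) (n - 1) -
      z ^ des τ * q ^ inv τ * qBinom q (n - s) (p - s) *
        invSum q (blockWeight z τ) (n - (p - 1)) := by
  have hmatch : ∑ w ∈ arrangements (Finset.range n), q ^ listInv w *
      (if HeadMatch τ w then blockWeight z τ (w.drop (p - 1)) else 0) =
      q ^ inv τ * qBinom q (n - s) (p - s) * invSum q (blockWeight z τ) (n - (p - 1)) := by
    rcases le_or_gt p n with hpn | hpn
    · rw [sum_match_blockWeight q hp hfirst hs hsp.le hlast hpn, gaussSum_eq_qBinom hq,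
        Nat.card_Ico]
    · rw [qBinom, if_neg (by omega), mul_zero, zero_mul]
      refine Finset.sum_eq_zero fun w hw => ?_
      have hl := length_of_mem_arrangements hw
      rw [Finset.card_range] at hl
      rw [if_neg (fun h => by have := h.1; omega), mul_zero]
  rw [mul_assoc, mul_assoc, ← mul_assoc (q ^ inv τ), ← hmatch,
    ← sum_ascent_blockWeight q hp hfirst hn, invSum, Finset.mul_sum, Finset.mul_sum,
    ← Finset.sum_sub_distrib]
  refine Finset.sum_congr rfl fun w hw => ?_
  have hl := length_of_mem_arrangements hw
  rw [Finset.card_range] at hl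
  rw [blockWeight_of_two_le_length (by omega) (by omega)]
  ring

theorem invSum_avoidWeight (hq : ∀ n, qFact q n ≠ 0) (hp : 3 ≤ p) (hτ : MinOverlapping τ) {n : ℕ}
    (hn : 1 ≤ n) :
    invSum q (avoidWeight z τ) n = invSum q (blockWeight z τ) n +
      ∑ k ∈ Finset.Ico 1 n, z * (qBinom q n k * invSum q (blockWeight z τ) k *
        invSum q (avoidWeight z τ) (n - k)) := by
  have hsplit : ∀ k ∈ Finset.Ico 1 n, z * (qBinom q n k * invSum q (blockWeight z τ) k *
      invSum q (avoidWeight z τ) (n - k)) = ∑ w ∈ arrangements (Finset.range n), q ^ listInv w *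
        (z * (blockWeight z τ (w.take k) * avoidWeight z τ (w.drop k))) := by
    intro k hk
    rw [Finset.mem_Ico] at hk
    have h := sum_arrangements_take_drop q (orderInvariant_blockWeight z τ)
      (orderInvariant_avoidWeight z τ) (S := Finset.range n) (k := k) (by simp; omega)
    rw [gaussSum_eq_qBinom hq, Finset.card_range] at h
    rw [← h, Finset.mul_sum]
    exact Finset.sum_congr rfl fun w _ => by ring
  rw [Finset.sum_congr rfl hsplit, Finset.sum_comm, invSum, invSum, ← Finset.sum_add_distrib]
  refine Finset.sum_congr rfl fun w hw => ?_
  have hl := length_of_mem_arrangements hw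
  rw [Finset.card_range] at hl
  rw [avoidWeight_eq_sum hp hτ w (mem_arrangements.1 hw).1 (by rintro rfl; simp at hl; omega), hl,
    mul_add, Finset.mul_sum]

variable (q z τ) in
theorem INM_eq_invSum (hp : 0 < p) {n : ℕ} (hn : 1 ≤ n) :
    INM τ n q z = z * invSum q (avoidWeight z τ) n := by
  rw [INM, if_neg (by omega), NM, Finset.sum_filter, invSum, ← sum_permWord, Finset.mul_sum]
  refine Finset.sum_congr rfl fun σ _ => ?_
  rw [avoidWeight, listInv_permWord, listDes_permWord,
    if_congr (mch_eq_zero_iff hp τ σ) rfl rfl]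
  split_ifs <;> ring

theorem qBinom_zero_right (hq : ∀ n, qFact q n ≠ 0) (n : ℕ) : qBinom q n 0 = 1 := by
  simp [qBinom, qFact, hq]

theorem qBinom_self (hq : ∀ n, qFact q n ≠ 0) (n : ℕ) : qBinom q n n = 1 := by
  simp [qBinom, qFact, hq]

theorem eq_neg_mul_invSum_blockWeight (hq : ∀ n, qFact q n ≠ 0) (hp : 3 ≤ p)
    (hτ : MinOverlapping τ) {IU : ℕ → K} (hIU0 : IU 0 = 1)
    (hIU : ∀ n, 1 ≤ n →
      ∑ k ∈ Finset.range (n + 1), qBinom q n k * IU k * INM τ (n - k) q z = 0) {n : ℕ}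
    (hn : 1 ≤ n) : IU n = -z * invSum q (blockWeight z τ) n := by
  induction n using Nat.strong_induction_on with
  | _ n ih =>
    have h := hIU n hn
    rw [Finset.sum_range_succ, Finset.range_eq_Ico, Finset.sum_eq_sum_Ico_succ_bot (by omega),
      hIU0, qBinom_zero_right hq, qBinom_self hq, Nat.sub_zero, Nat.sub_self,
      INM_eq_invSum q z τ (by omega) hn, invSum_avoidWeight hq hp hτ hn] at h
    have hsum : ∑ k ∈ Finset.Ico 1 n, qBinom q n k * IU k * INM τ (n - k) q z =
        -(z * ∑ k ∈ Finset.Ico 1 n, z * (qBinom q n k * invSum q (blockWeight z τ) k *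
          invSum q (avoidWeight z τ) (n - k))) := by
      rw [Finset.mul_sum, ← Finset.sum_neg_distrib]
      refine Finset.sum_congr rfl fun k hk => ?_
      rw [Finset.mem_Ico] at hk
      rw [ih k hk.2 hk.1, INM_eq_invSum q z τ (by omega) (by omega)]
      ring
    have h0 : INM τ 0 q z = 1 := if_pos rfl
    rw [zero_add, hsum, h0] at h
    linear_combination h

theorem qFact_pW_ne_zero (n : ℕ) : qFact pW n ≠ 0 := by
  induction n with
  | zero => exact one_ne_zero
  | succ n ih =>
    refine mul_ne_zero ih fun h => ?_
    have hpoly : qInt pW (n + 1) = algebraMap (MvPolynomial (Fin 2) ℚ) K2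
        (∑ i ∈ Finset.range (n + 1), MvPolynomial.X 0 ^ i) := by
      simp [qInt, pW]
    rw [hpoly, FaithfulSMul.algebraMap_eq_zero_iff] at h
    have := congrArg (MvPolynomial.eval fun _ => (1 : ℚ)) h
    simp only [map_sum, map_pow, MvPolynomial.eval_X, one_pow, Finset.sum_const,
      Finset.card_range, nsmul_eq_mul, mul_one, map_zero, Nat.cast_eq_zero] at this
    omega

end Main

/-- Theorem: let `τ ∈ S_p` (`p ≥ 3`) be minimal overlapping with `τ_1 = 1` and
`τ_p = s`, `2 ≤ s < p`.  If `IU : ℕ → ℚ(q,z)` satisfies the defining relations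
`IU 0 = 1` and `Σ_{k=0}^n [n choose k]_q IU_k INM_{τ,n-k} = 0` for `n ≥ 1`, then
`IU 1 = -z` and, for all `n ≥ 2`,
`IU n = (1-z) IU (n-1) - z^{des τ} q^{inv τ} [n-s choose p-s]_q IU (n-(p-1))`,
where the `q`-binomial coefficient is `0` whenever `n - s < p - s`.
Here `q = X 0` and `z = X 1` in `ℚ(q,z)`. -/
theorem stmt11 {p : ℕ} (hp : 3 ≤ p) (τ : Equiv.Perm (Fin p)) (hτ : MinOverlapping τ)
    (s : ℕ) (hs2 : 2 ≤ s) (hsp : s < p)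
    (hfirst : τ ⟨0, by omega⟩ = ⟨0, by omega⟩)
    (hlast : τ ⟨p - 1, by omega⟩ = ⟨s - 1, by omega⟩)
    (IU : ℕ → K2) (hIU0 : IU 0 = 1)
    (hIUdef : ∀ n : ℕ, 1 ≤ n →
      ∑ k ∈ Finset.range (n + 1), qBinom pW n k * IU k * INM τ (n - k) pW qW = 0) :
    IU 1 = -qW ∧
    ∀ n : ℕ, 2 ≤ n →
      IU n = (1 - qW) * IU (n - 1) -
        qW ^ des τ * pW ^ inv τ * qBinom pW (n - s) (p - s) * IU (n - (p - 1)) := by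
  have h := fun {n : ℕ} (hn : 1 ≤ n) =>
    eq_neg_mul_invSum_blockWeight qFact_pW_ne_zero hp hτ hIU0 hIUdef hn
  refine ⟨?_, fun n hn => ?_⟩
  · rw [h le_rfl, invSum_one, blockWeight, mul_one]
  · have hrec := invSum_blockWeight_recursion (q := pW) (z := qW) qFact_pW_ne_zero hp hfirst
      (by omega) hsp hlast hn
    rcases le_or_gt p n with hpn | hpn
    · rw [h (by omega), h (by omega), h (by omega), hrec]
      ring
    · rw [qBinom, if_neg (by omega)] at hrec ⊢
      rw [h (by omega), h (by omega), hrec]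
      ring

end CWilf
end
end

section
/- Suppose j ≥ 3 and α = α_1⋯α_j and β = β_1⋯β_j are mutually minimal overlapping permutations in S_j, and there is an a with 1 ≤ a < j such that α_i = β_i for all i ≤ a, α_a = β_a = 1, α_j = β_j, and des(α) = des(β). For n ≥ 0 let A_n = {σ ∈ S_n : α-mch(σ) > 0 and β-mch(σ) = 0} and B_n = {σ ∈ S_n : β-mch(σ) > 0 and α-mch(σ) = 0}. Then for all n ≥ 0, Σ_{σ∈A_n} z^{des(σ)} u^{LRmin(σ)} = Σ_{σ∈B_n} z^{des(σ)} u^{LRmin(σ)} as polynomials in z and u; if in addition inv(α) = inv(β), then Σ_{σ∈A_n} z^{des(σ)} u^{LRmin(σ)} q^{inv(σ)} = Σ_{σ∈B_n} z^{des(σ)} u^{LRmin(σ)} q^{inv(σ)} as polynomials in z, u and q. -/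
open scoped Classical

noncomputable section

namespace CWilf

open Equiv (Perm)

section Exchange

variable {j n : ℕ}

lemma MatchAt.le {τ : Perm (Fin j)} {σ : Perm (Fin n)} {p : ℕ} (h : MatchAt τ σ p) :
    p + j ≤ n := h.1

/-- Matches at `p` only depend on the entries in positions `p, …, p + j - 1`. -/
lemma matchAt_congr {τ : Perm (Fin j)} {σ σ' : Perm (Fin n)} {p : ℕ}
    (h : ∀ x : Fin n, p ≤ x → (x : ℕ) < p + j → σ x = σ' x) :
    MatchAt τ σ p ↔ MatchAt τ σ' p := by
  unfold MatchAt
  refine exists_congr fun hp => forall_congr' fun a => forall_congr' fun b => ?_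
  have ha := a.isLt
  have hb := b.isLt
  rw [h ⟨p + a, by omega⟩ (by simp) (by simp), h ⟨p + b, by omega⟩ (by simp) (by simp)]

/-- Every window of a permutation can be reduced to a permutation. -/
lemma exists_reduction (σ : Perm (Fin n)) {p m : ℕ} (hpm : p + m ≤ n) :
    ∃ ρ : Perm (Fin m), ∀ x y : Fin m,
      ρ x < ρ y ↔ σ ⟨p + x, by omega⟩ < σ ⟨p + y, by omega⟩ := by
  set f : Fin m → Fin n := fun x => σ ⟨p + x, by omega⟩ with hf
  have hinj : Function.Injective f := by
    intro x y hxy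
    have := σ.injective hxy
    simp only [Fin.mk.injEq] at this
    exact Fin.ext (by omega)
  have hmono : StrictMono (f ∘ Tuple.sort f) :=
    (Tuple.monotone_sort f).strictMono_of_injective (hinj.comp (Tuple.sort f).injective)
  refine ⟨(Tuple.sort f)⁻¹, fun x y => ?_⟩
  rw [← hmono.lt_iff_lt]
  simp [hf]

/-- A window containing matches reduces to a permutation with the corresponding matches. -/
lemma exists_reduction_matchAt (σ : Perm (Fin n)) {p m : ℕ} (hpm : p + m ≤ n) :
    ∃ ρ : Perm (Fin m), ∀ (τ : Perm (Fin j)) (i : ℕ),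
      MatchAt τ ρ i ↔ i + j ≤ m ∧ MatchAt τ σ (p + i) := by
  obtain ⟨ρ, hρ⟩ := exists_reduction σ hpm
  refine ⟨ρ, fun τ i => ⟨fun ⟨hi, h⟩ => ⟨hi, by omega, fun a b => ?_⟩,
    fun ⟨hi, _, h⟩ => ⟨hi, fun a b => ?_⟩⟩⟩
  · rw [h a b, hρ]
    simp only [Nat.add_assoc]
  · rw [h a b, hρ]
    simp only [Nat.add_assoc]

/-- Windows of length `j` starting at `p` and `q` share at most one position. -/
def Apart (j p q : ℕ) : Prop := p + j ≤ q + 1 ∨ q + j ≤ p + 1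

lemma Apart.symm {p q : ℕ} (h : Apart j p q) : Apart j q p := Or.symm h

/-- Two matches of a minimal overlapping permutation share at most one position. -/
lemma MinOverlapping.apart {τ : Perm (Fin j)} (hj : 0 < j) (hτ : MinOverlapping τ)
    (σ : Perm (Fin n)) (p q : ℕ) (hpq : p ≠ q) (hp : MatchAt τ σ p) (hq : MatchAt τ σ q) :
    Apart j p q := by
  have key : ∀ d, 0 < d → ∀ p, MatchAt τ σ p → MatchAt τ σ (p + d) → j ≤ d + 1 := by
    intro d
    induction d using Nat.strong_induction_on with
    | _ d ih =>
      intro hd p hp hq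
      by_contra hlt
      have hle := hq.le
      obtain ⟨ρ, hρ⟩ := exists_reduction_matchAt (j := j) σ (p := p) (m := d + j) (by omega)
      have hmch : mch τ ρ = 2 := by
        have : (Finset.range (d + j)).filter (fun i => MatchAt τ ρ i) = {0, d} := by
          ext i
          simp only [Finset.mem_filter, Finset.mem_range, Finset.mem_insert,
            Finset.mem_singleton, hρ]
          constructor
          · rintro ⟨_, hi, hm⟩
            by_contra hne
            have := ih i (by omega) (by omega) p hp hm
            omega
          · rintro (rfl | rfl)
            · exact ⟨by omega, by omega, hp⟩
            · exact ⟨by omega, by omega, hq⟩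
        rw [mch, this, Finset.card_pair (by omega)]
      have := hτ.2 ⟨ρ, hmch⟩
      omega
  rcases Nat.lt_or_gt_of_ne hpq with h | h
  · have := key (q - p) (by omega) p hp (by rwa [Nat.add_sub_cancel' h.le])
    exact Or.inl (by omega)
  · have := key (p - q) (by omega) q hq (by rwa [Nat.add_sub_cancel' h.le])
    exact Or.inr (by omega)

lemma one_le_mch {τ : Perm (Fin j)} (hj : 0 < j) {σ : Perm (Fin n)} {p : ℕ}
    (h : MatchAt τ σ p) : 1 ≤ mch τ σ := by
  have := h.le
  exact Finset.card_pos.2 ⟨p, Finset.mem_filter.2 ⟨Finset.mem_range.2 (by omega), h⟩⟩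

/-- Matches of two mutually minimal overlapping permutations share at most one position. -/
lemma MutuallyMinOverlapping.apart {α β : Perm (Fin j)} (hj : 0 < j)
    (h : MutuallyMinOverlapping α β) (σ : Perm (Fin n)) (p q : ℕ)
    (hp : MatchAt α σ p) (hq : MatchAt β σ q) : Apart j p q := by
  have hple := hp.le
  have hqle := hq.le
  rcases le_total p q with hpq | hpq
  · obtain ⟨ρ, hρ⟩ := exists_reduction_matchAt (j := j) σ (p := p) (m := q - p + j) (by omega)
    have := h.2.2.2 ⟨ρ, one_le_mch hj ((hρ α 0).2 ⟨by omega, hp⟩),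
      one_le_mch hj ((hρ β (q - p)).2 ⟨le_rfl, by rwa [Nat.add_sub_cancel' hpq]⟩)⟩
    exact Or.inl (by omega)
  · obtain ⟨ρ, hρ⟩ := exists_reduction_matchAt (j := j) σ (p := q) (m := p - q + j) (by omega)
    have := h.2.2.2 ⟨ρ, one_le_mch hj
      ((hρ α (p - q)).2 ⟨le_rfl, by rwa [Nat.add_sub_cancel' hpq]⟩),
      one_le_mch hj ((hρ β 0).2 ⟨by omega, hq⟩)⟩
    exact Or.inr (by omega)

/-- The embedding of `Fin j` as the positions `p, …, p + j - 1`. -/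
def window {p : ℕ} (h : p + j ≤ n) : Fin j ↪ Fin n where
  toFun b := ⟨p + b, by omega⟩
  inj' b c hbc := Fin.ext (by simpa using hbc)

@[simp] lemma window_val {p : ℕ} (h : p + j ≤ n) (b : Fin j) :
    (window h b : ℕ) = p + b := rfl

lemma matchAt_iff {τ : Perm (Fin j)} {σ : Perm (Fin n)} {p : ℕ} (h : p + j ≤ n) :
    MatchAt τ σ p ↔ ∀ a b : Fin j, τ a < τ b ↔ σ (window h a) < σ (window h b) :=
  ⟨fun ⟨_, h'⟩ => h', fun h' => ⟨h, h'⟩⟩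

/-- The permutation of positions acting as `π` on the window starting at `p`. -/
def shuffle (n p : ℕ) (π : Perm (Fin j)) : Perm (Fin n) :=
  if h : p + j ≤ n then π.viaEmbedding (window h) else 1

lemma shuffle_window {p : ℕ} (h : p + j ≤ n) (π : Perm (Fin j)) (b : Fin j) :
    shuffle n p π (window h b) = window h (π b) := by
  rw [shuffle, dif_pos h, Perm.viaEmbedding_apply]

lemma shuffle_of_not_mem {p : ℕ} (π : Perm (Fin j)) {x : Fin n}
    (hx : ¬ (p ≤ (x : ℕ) ∧ (x : ℕ) < p + j)) : shuffle n p π x = x := by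
  rw [shuffle]
  split_ifs with h
  · refine Perm.viaEmbedding_apply_of_notMem _ _ _ ?_
    rintro ⟨b, rfl⟩
    exact hx (by simp)
  · rfl

lemma exists_window {p : ℕ} (h : p + j ≤ n) {x : Fin n} (h1 : p ≤ (x : ℕ))
    (h2 : (x : ℕ) < p + j) : ∃ b, window h b = x :=
  ⟨⟨x - p, by omega⟩, Fin.ext (by simp; omega)⟩

lemma shuffle_mem_iff {p : ℕ} (π : Perm (Fin j)) (x : Fin n) (h : p + j ≤ n) :
    (p ≤ (shuffle n p π x : ℕ) ∧ (shuffle n p π x : ℕ) < p + j) ↔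
      (p ≤ (x : ℕ) ∧ (x : ℕ) < p + j) := by
  by_cases hx : p ≤ (x : ℕ) ∧ (x : ℕ) < p + j
  · obtain ⟨b, rfl⟩ := exists_window h hx.1 hx.2
    simp [shuffle_window]
  · rw [shuffle_of_not_mem π hx]

lemma shuffle_mul {p : ℕ} (π ρ : Perm (Fin j)) :
    shuffle n p (π * ρ) = shuffle n p π * shuffle n p ρ := by
  unfold shuffle
  split_ifs with h
  · exact map_mul (Perm.viaEmbeddingHom (window h)) π ρ
  · rfl

lemma shuffle_one {p : ℕ} : shuffle n p (1 : Perm (Fin j)) = 1 := by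
  unfold shuffle
  split_ifs with h
  · exact map_one (Perm.viaEmbeddingHom (window h))
  · rfl

lemma matchAt_mul_shuffle {α β : Perm (Fin j)} {σ : Perm (Fin n)} {p : ℕ}
    (h : MatchAt α σ p) : MatchAt β (σ * shuffle n p (α⁻¹ * β)) p := by
  have hp := h.le
  rw [matchAt_iff hp] at h ⊢
  intro a b
  simp [shuffle_window, ← h]

/-- The hypotheses on `α` and `β` under which replacing an `α`-match by a `β`-match preserves
all other matches, the descents and the left-to-right minima; `a` is the (0-based) position of
the smallest letter. -/
structure Exchangeable (α β : Perm (Fin j)) (a : ℕ) : Prop where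
  lt : a < j
  apart_left : ∀ {n : ℕ} (σ : Perm (Fin n)) (p q : ℕ), p ≠ q → MatchAt α σ p →
    MatchAt α σ q → Apart j p q
  apart_right : ∀ {n : ℕ} (σ : Perm (Fin n)) (p q : ℕ), p ≠ q → MatchAt β σ p →
    MatchAt β σ q → Apart j p q
  apart_mixed : ∀ {n : ℕ} (σ : Perm (Fin n)) (p q : ℕ), MatchAt α σ p →
    MatchAt β σ q → Apart j p q
  two_le : 2 ≤ j
  agree : ∀ b : Fin j, (b : ℕ) ≤ a ∨ (b : ℕ) + 1 = j → α b = β b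
  min_left : ∀ b : Fin j, b ≠ ⟨a, lt⟩ → α ⟨a, lt⟩ < α b
  des_eq : des α = des β

lemma Exchangeable.min_right {α β : Perm (Fin j)} {a : ℕ} (h : Exchangeable α β a) (b : Fin j)
    (hb : b ≠ ⟨a, h.lt⟩) : β ⟨a, h.lt⟩ < β b := by
  have key := h.agree ⟨a, h.lt⟩ (Or.inl le_rfl)
  rw [← key]
  have := h.min_left (α⁻¹ (β b)) (by
    intro h'
    have h2 : β b = α ⟨a, h.lt⟩ := by rw [← h']; simp
    rw [key] at h2
    exact hb (β.injective h2))
  simpa using this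

lemma Exchangeable.symm {α β : Perm (Fin j)} {a : ℕ} (h : Exchangeable α β a) :
    Exchangeable β α a where
  lt := h.lt
  apart_left := h.apart_right
  apart_right := h.apart_left
  apart_mixed σ p q hp hq := (h.apart_mixed σ q p hq hp).symm
  two_le := h.two_le
  agree b hb := (h.agree b hb).symm
  min_left := h.min_right
  des_eq := h.des_eq.symm

lemma Exchangeable.shuffle_of_le {α β : Perm (Fin j)} {a : ℕ} (h : Exchangeable α β a)
    {p : ℕ} {x : Fin n} (hx : (x : ℕ) ≤ p + a ∨ p + j ≤ (x : ℕ) + 1) :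
    shuffle n p (α⁻¹ * β) x = x := by
  by_cases hp : p + j ≤ n
  · by_cases hxw : p ≤ (x : ℕ) ∧ (x : ℕ) < p + j
    · obtain ⟨b, rfl⟩ := exists_window hp hxw.1 hxw.2
      rw [shuffle_window, Perm.mul_apply, ← h.agree b]
      · simp
      · simp at hx
        omega
    · exact shuffle_of_not_mem _ hxw
  · rw [shuffle, dif_neg hp]
    rfl

lemma Exchangeable.matchAt_iff_of_ne {α β τ : Perm (Fin j)} {a : ℕ} (h : Exchangeable α β a)
    {σ : Perm (Fin n)} {p q : ℕ} (hσ : MatchAt α σ p) (hpq : q ≠ p) (hτ : τ = α ∨ τ = β) :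
    MatchAt τ (σ * shuffle n p (α⁻¹ * β)) q ↔ MatchAt τ σ q := by
  by_cases hap : Apart j p q
  · refine matchAt_congr fun x hx1 hx2 => ?_
    rw [Perm.mul_apply, h.shuffle_of_le]
    rcases hap with hap | hap <;> omega
  · have hσ' : MatchAt β (σ * shuffle n p (α⁻¹ * β)) p := matchAt_mul_shuffle hσ
    rcases hτ with rfl | rfl
    · exact ⟨fun hm => (hap (h.apart_mixed _ q p hm hσ').symm).elim,
        fun hm => (hap (h.apart_left _ p q hpq.symm hσ hm)).elim⟩
    · exact ⟨fun hm => (hap (h.apart_right _ p q hpq.symm hσ' hm)).elim,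
        fun hm => (hap (h.apart_mixed _ p q hσ hm)).elim⟩

lemma card_des_window {τ : Perm (Fin j)} {σ : Perm (Fin n)} {p : ℕ} (h : MatchAt τ σ p) :
    (Finset.univ.filter fun i : Fin n =>
      (∃ h : (i : ℕ) + 1 < n, σ ⟨(i : ℕ) + 1, h⟩ < σ i) ∧
        (p ≤ (i : ℕ) ∧ (i : ℕ) + 1 < p + j)).card = des τ := by
  have hp := h.le
  rw [matchAt_iff hp] at h
  unfold des
  rw [← Finset.card_map (window hp)]
  congr 1
  ext x
  simp only [Finset.mem_filter, Finset.mem_univ, true_and, Finset.mem_map]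
  constructor
  · rintro ⟨⟨hx, hd⟩, h1, h2⟩
    obtain ⟨b, rfl⟩ := exists_window hp h1 (by omega)
    have hb : (b : ℕ) + 1 < j := by simp at h2; omega
    exact ⟨b, ⟨hb, (h _ _).2 hd⟩, rfl⟩
  · rintro ⟨b, ⟨hb, hd⟩, rfl⟩
    exact ⟨⟨by simp; omega, (h _ _).1 hd⟩, by simp, by simp; omega⟩

lemma Exchangeable.des_mul_shuffle {α β : Perm (Fin j)} {a : ℕ} (h : Exchangeable α β a)
    {σ : Perm (Fin n)} {p : ℕ} (hσ : MatchAt α σ p) :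
    des (σ * shuffle n p (α⁻¹ * β)) = des σ := by
  have hσ' : MatchAt β (σ * shuffle n p (α⁻¹ * β)) p := matchAt_mul_shuffle hσ
  have h1 := card_des_window hσ
  have h2 := card_des_window hσ'
  have h3 := h.des_eq
  rw [← h1, ← h2] at h3
  unfold des
  rw [← Finset.card_filter_add_card_filter_not
      (s := Finset.univ.filter fun i : Fin n =>
        ∃ h : (i : ℕ) + 1 < n, σ ⟨(i : ℕ) + 1, h⟩ < σ i)
      (fun i : Fin n => p ≤ (i : ℕ) ∧ (i : ℕ) + 1 < p + j),
    ← Finset.card_filter_add_card_filter_not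
      (s := Finset.univ.filter fun i : Fin n =>
        ∃ h : (i : ℕ) + 1 < n, (σ * shuffle n p (α⁻¹ * β)) ⟨(i : ℕ) + 1, h⟩ <
          (σ * shuffle n p (α⁻¹ * β)) i)
      (fun i : Fin n => p ≤ (i : ℕ) ∧ (i : ℕ) + 1 < p + j)]
  simp only [Finset.filter_filter]
  rw [h3]
  congr 2
  refine Finset.filter_congr fun i _ => and_congr_left fun hi => exists_congr fun hin => ?_
  rw [Perm.mul_apply, Perm.mul_apply, h.shuffle_of_le, h.shuffle_of_le]
  · omega
  · have := h.lt
    simp only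
    omega

lemma Exchangeable.LRmin_mul_shuffle {α β : Perm (Fin j)} {a : ℕ} (h : Exchangeable α β a)
    {σ : Perm (Fin n)} {p : ℕ} (hσ : MatchAt α σ p) :
    LRmin (σ * shuffle n p (α⁻¹ * β)) = LRmin σ := by
  have hp := hσ.le
  have hlt := h.lt
  have hm := (matchAt_iff hp).1 hσ
  have hm' := (matchAt_iff hp).1 (matchAt_mul_shuffle (β := β) hσ)
  unfold LRmin
  congr 1
  refine Finset.filter_congr fun y _ => ?_
  by_cases hy1 : (y : ℕ) ≤ p + a
  · refine forall_congr' fun i => forall_congr' fun hi => ?_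
    have : (i : ℕ) < y := hi
    rw [Perm.mul_apply, Perm.mul_apply, h.shuffle_of_le (Or.inl hy1),
      h.shuffle_of_le (Or.inl (by omega))]
  by_cases hy2 : (y : ℕ) < p + j
  · obtain ⟨b, rfl⟩ := exists_window hp (by omega) hy2
    simp only [window_val] at hy1
    have hb : b ≠ ⟨a, h.lt⟩ := by
      rintro rfl
      simp at hy1
    have hlt' : window hp ⟨a, h.lt⟩ < window hp b := by
      rw [Fin.lt_def]
      simp only [window_val]
      omega
    refine iff_of_false (fun H => ?_) (fun H => ?_)
    · exact lt_asymm (H _ hlt') ((hm' _ _).1 (h.min_right b hb))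
    · exact lt_asymm (H _ hlt') ((hm _ _).1 (h.min_left b hb))
  · have hy : shuffle n p (α⁻¹ * β) y = y := h.shuffle_of_le (Or.inr (by omega))
    have hmem : ∀ i : Fin n, i < y ↔ shuffle n p (α⁻¹ * β) i < y := by
      intro i
      have hiff := shuffle_mem_iff (α⁻¹ * β) i hp
      by_cases hi : p ≤ (i : ℕ) ∧ (i : ℕ) < p + j
      · have := hiff.2 hi
        simp only [Fin.lt_def]
        omega
      · rw [shuffle_of_not_mem _ hi]
    refine Equiv.forall_congr (shuffle n p (α⁻¹ * β)) fun i => ?_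
    rw [← hmem i, Perm.mul_apply, Perm.mul_apply, hy]

lemma card_inv_window {τ : Perm (Fin j)} {σ : Perm (Fin n)} {p : ℕ} (h : MatchAt τ σ p) :
    (Finset.univ.filter fun x : Fin n × Fin n =>
      (x.1 < x.2 ∧ σ x.2 < σ x.1) ∧ (p ≤ (x.1 : ℕ) ∧ (x.2 : ℕ) < p + j)).card = inv τ := by
  have hp := h.le
  rw [matchAt_iff hp] at h
  unfold inv
  rw [← Finset.card_map ((window hp).prodMap (window hp))]
  congr 1
  ext ⟨x, y⟩
  simp only [Finset.mem_filter, Finset.mem_univ, true_and, Finset.mem_map,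
    Function.Embedding.coe_prodMap, Prod.exists, Prod.map_apply, Prod.mk.injEq]
  constructor
  · rintro ⟨⟨hxy, hd⟩, h1, h2⟩
    rw [Fin.lt_def] at hxy
    obtain ⟨b, rfl⟩ := exists_window hp h1 (by omega)
    obtain ⟨c, rfl⟩ := exists_window hp (by omega) h2
    refine ⟨b, c, ⟨?_, (h _ _).2 hd⟩, rfl, rfl⟩
    simp only [window_val] at hxy
    rw [Fin.lt_def]
    omega
  · rintro ⟨b, c, ⟨hb, hd⟩, rfl, rfl⟩
    rw [Fin.lt_def] at hb
    exact ⟨⟨Nat.add_lt_add_left hb p, (h _ _).1 hd⟩, by simp, by simp⟩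

lemma shuffle_lt_shuffle_iff {p : ℕ} (π : Perm (Fin j)) (x y : Fin n) (hp : p + j ≤ n) :
    (x < y ∧ ¬ (p ≤ (x : ℕ) ∧ (y : ℕ) < p + j)) ↔
      (shuffle n p π x < shuffle n p π y ∧
        ¬ (p ≤ (shuffle n p π x : ℕ) ∧ (shuffle n p π y : ℕ) < p + j)) := by
  have hx := shuffle_mem_iff π x hp
  have hy := shuffle_mem_iff π y hp
  have hx' := fun hx => congrArg Fin.val (shuffle_of_not_mem (p := p) π (x := x) hx)
  have hy' := fun hy => congrArg Fin.val (shuffle_of_not_mem (p := p) π (x := y) hy)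
  simp only [Fin.lt_def]
  generalize (shuffle n p π x : ℕ) = x' at *
  generalize (shuffle n p π y : ℕ) = y' at *
  by_cases hxw : p ≤ (x : ℕ) ∧ (x : ℕ) < p + j <;>
  by_cases hyw : p ≤ (y : ℕ) ∧ (y : ℕ) < p + j
  · omega
  · have := hy' hyw
    omega
  · have := hx' hxw
    omega
  · rw [hx' hxw, hy' hyw]

lemma inv_mul_shuffle {α β : Perm (Fin j)} (hinv : inv α = inv β)
    {σ : Perm (Fin n)} {p : ℕ} (hσ : MatchAt α σ p) :
    inv (σ * shuffle n p (α⁻¹ * β)) = inv σ := by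
  have hp := hσ.le
  have hσ' : MatchAt β (σ * shuffle n p (α⁻¹ * β)) p := matchAt_mul_shuffle hσ
  have h1 := card_inv_window hσ
  have h2 := card_inv_window hσ'
  rw [← h1, ← h2] at hinv
  unfold inv
  rw [← Finset.card_filter_add_card_filter_not
      (s := Finset.univ.filter fun x : Fin n × Fin n => x.1 < x.2 ∧ σ x.2 < σ x.1)
      (fun x : Fin n × Fin n => p ≤ (x.1 : ℕ) ∧ (x.2 : ℕ) < p + j),
    ← Finset.card_filter_add_card_filter_not
      (s := Finset.univ.filter fun x : Fin n × Fin n => x.1 < x.2 ∧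
        (σ * shuffle n p (α⁻¹ * β)) x.2 < (σ * shuffle n p (α⁻¹ * β)) x.1)
      (fun x : Fin n × Fin n => p ≤ (x.1 : ℕ) ∧ (x.2 : ℕ) < p + j)]
  simp only [Finset.filter_filter]
  rw [hinv]
  congr 1
  set w := shuffle n p (α⁻¹ * β) with hw
  refine Finset.card_equiv (Equiv.prodCongr w w) fun ⟨x, y⟩ => ?_
  have := shuffle_lt_shuffle_iff (α⁻¹ * β) x y hp
  rw [← hw] at this
  rw [Finset.mem_filter, Finset.mem_filter]
  simp only [Finset.mem_univ, true_and, Equiv.prodCongr_apply, Prod.map_apply, Perm.mul_apply]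
  rw [and_right_comm, this, and_right_comm]

/-- Exchange an `α`-match or a `β`-match at position `p` for one of the other kind. -/
def exchange (α β : Perm (Fin j)) (p : ℕ) (σ : Perm (Fin n)) : Perm (Fin n) :=
  if MatchAt α σ p then σ * shuffle n p (α⁻¹ * β)
  else if MatchAt β σ p then σ * shuffle n p (β⁻¹ * α) else σ

lemma Exchangeable.not_matchAt {α β : Perm (Fin j)} {a : ℕ} (h : Exchangeable α β a)
    {σ : Perm (Fin n)} {p : ℕ} (hσ : MatchAt α σ p) : ¬ MatchAt β σ p := by
  intro hσ'
  have := h.two_le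
  rcases h.apart_mixed σ p p hσ hσ' with h | h <;> omega

/-- To show a relation between `σ` and `exchange α β p σ` it suffices to treat replacing one
match, in either direction, and leaving `σ` unchanged. -/
lemma exchange_cases {α β : Perm (Fin j)} {p : ℕ} {P : Perm (Fin n) → Prop} (σ : Perm (Fin n))
    (hα : MatchAt α σ p → P (σ * shuffle n p (α⁻¹ * β)))
    (hβ : MatchAt β σ p → P (σ * shuffle n p (β⁻¹ * α)))
    (hσ : ¬ MatchAt α σ p → ¬ MatchAt β σ p → P σ) : P (exchange α β p σ) := by
  unfold exchange
  split_ifs with h1 h2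
  exacts [hα h1, hβ h2, hσ h1 h2]

lemma Exchangeable.exchange_involutive {α β : Perm (Fin j)} {a : ℕ} (h : Exchangeable α β a)
    (p : ℕ) : Function.Involutive (exchange α β p : Perm (Fin n) → Perm (Fin n)) := by
  intro σ
  by_cases h1 : MatchAt α σ p
  · have h2 : MatchAt β (σ * shuffle n p (α⁻¹ * β)) p := matchAt_mul_shuffle h1
    have h3 := h.symm.not_matchAt h2
    rw [show exchange α β p σ = _ from if_pos h1, exchange, if_neg h3, if_pos h2, mul_assoc,
      ← shuffle_mul]
    simp [shuffle_one]
  by_cases h2 : MatchAt β σ p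
  · have h3 : MatchAt α (σ * shuffle n p (β⁻¹ * α)) p := matchAt_mul_shuffle h2
    rw [show exchange α β p σ = _ from (if_neg h1).trans (if_pos h2), exchange, if_pos h3,
      mul_assoc, ← shuffle_mul]
    simp [shuffle_one]
  · have : exchange α β p σ = σ := (if_neg h1).trans (if_neg h2)
    rw [this, this]

lemma Exchangeable.matchAt_exchange_of_ne {α β τ : Perm (Fin j)} {a : ℕ}
    (h : Exchangeable α β a) {p q : ℕ} (hpq : q ≠ p) (hτ : τ = α ∨ τ = β) (σ : Perm (Fin n)) :
    MatchAt τ (exchange α β p σ) q ↔ MatchAt τ σ q :=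
  exchange_cases (P := fun ρ => MatchAt τ ρ q ↔ MatchAt τ σ q) σ
    (fun hm => h.matchAt_iff_of_ne hm hpq hτ)
    (fun hm => h.symm.matchAt_iff_of_ne hm hpq hτ.symm) (fun _ _ => Iff.rfl)

lemma Exchangeable.matchAt_left_exchange {α β : Perm (Fin j)} {a : ℕ}
    (h : Exchangeable α β a) (p : ℕ) (σ : Perm (Fin n)) :
    MatchAt α (exchange α β p σ) p ↔ MatchAt β σ p :=
  exchange_cases (P := fun ρ => MatchAt α ρ p ↔ MatchAt β σ p) σ
    (fun hm => iff_of_false (h.symm.not_matchAt (matchAt_mul_shuffle hm)) (h.not_matchAt hm))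
    (fun hm => iff_of_true (matchAt_mul_shuffle hm) hm) (fun h1 h2 => iff_of_false h1 h2)

lemma Exchangeable.matchAt_right_exchange {α β : Perm (Fin j)} {a : ℕ}
    (h : Exchangeable α β a) (p : ℕ) (σ : Perm (Fin n)) :
    MatchAt β (exchange α β p σ) p ↔ MatchAt α σ p := by
  rw [← h.matchAt_left_exchange p (exchange α β p σ), h.exchange_involutive p σ]

/-- Exchanging all matches in positions below `k`. -/
lemma Exchangeable.exists_equiv_below {α β : Perm (Fin j)} {a : ℕ} (h : Exchangeable α β a)
    (n k : ℕ) : ∃ E : Perm (Fin n) ≃ Perm (Fin n), ∀ σ,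
      des (E σ) = des σ ∧ LRmin (E σ) = LRmin σ ∧ (inv α = inv β → inv (E σ) = inv σ) ∧
      (∀ q < k, (MatchAt α (E σ) q ↔ MatchAt β σ q) ∧ (MatchAt β (E σ) q ↔ MatchAt α σ q)) ∧
      ∀ q, k ≤ q →
        ((MatchAt α (E σ) q ↔ MatchAt α σ q) ∧ (MatchAt β (E σ) q ↔ MatchAt β σ q)) := by
  induction k with
  | zero => exact ⟨Equiv.refl _, fun σ => by simp⟩
  | succ k ih =>
    obtain ⟨E, hE⟩ := ih
    refine ⟨E.trans (h.exchange_involutive k).toPerm, fun σ => ?_⟩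
    obtain ⟨h1, h2, h3, h4, h5⟩ := hE σ
    simp only [Equiv.trans_apply, Function.Involutive.coe_toPerm]
    refine ⟨?_, ?_, fun hinv => ?_, fun q hq => ?_, fun q hq => ?_⟩
    · rw [← h1]
      exact exchange_cases (P := fun ρ => des ρ = des (E σ)) (E σ) h.des_mul_shuffle
        h.symm.des_mul_shuffle fun _ _ => rfl
    · rw [← h2]
      exact exchange_cases (P := fun ρ => LRmin ρ = LRmin (E σ)) (E σ) h.LRmin_mul_shuffle
        h.symm.LRmin_mul_shuffle fun _ _ => rfl
    · rw [← h3 hinv]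
      exact exchange_cases (P := fun ρ => inv ρ = inv (E σ)) (E σ) (inv_mul_shuffle hinv)
        (inv_mul_shuffle hinv.symm) fun _ _ => rfl
    · rcases Nat.lt_succ_iff_lt_or_eq.1 hq with hq | rfl
      · rw [h.matchAt_exchange_of_ne hq.ne (Or.inl rfl),
          h.matchAt_exchange_of_ne hq.ne (Or.inr rfl)]
        exact h4 q hq
      · rw [h.matchAt_left_exchange, h.matchAt_right_exchange]
        exact (h5 q le_rfl).symm
    · rw [h.matchAt_exchange_of_ne (by omega) (Or.inl rfl),
        h.matchAt_exchange_of_ne (by omega) (Or.inr rfl)]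
      exact h5 q (by omega)

/-- A bijection of `S_n` swapping `α`-matches and `β`-matches and preserving the statistics. -/
lemma Exchangeable.exists_equiv {α β : Perm (Fin j)} {a : ℕ} (h : Exchangeable α β a) (n : ℕ) :
    ∃ E : Perm (Fin n) ≃ Perm (Fin n), ∀ σ,
      des (E σ) = des σ ∧ LRmin (E σ) = LRmin σ ∧ (inv α = inv β → inv (E σ) = inv σ) ∧
      mch α (E σ) = mch β σ ∧ mch β (E σ) = mch α σ := by
  obtain ⟨E, hE⟩ := h.exists_equiv_below n n
  refine ⟨E, fun σ => ?_⟩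
  obtain ⟨h1, h2, h3, h4, -⟩ := hE σ
  refine ⟨h1, h2, h3, ?_, ?_⟩
  · exact congrArg Finset.card (Finset.filter_congr fun q hq => (h4 q (Finset.mem_range.1 hq)).1)
  · exact congrArg Finset.card (Finset.filter_congr fun q hq => (h4 q (Finset.mem_range.1 hq)).2)

end Exchange

/-- Theorem: with `α, β` mutually minimal overlapping as in the paper
(`α_i = β_i` for `i ≤ a`, `α_a = β_a = 1`, `α_j = β_j`, `des α = des β`), setting
`A_n = {σ ∈ S_n : α-mch σ > 0, β-mch σ = 0}` and
`B_n = {σ ∈ S_n : β-mch σ > 0, α-mch σ = 0}`, for all `n ≥ 0` the generating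
polynomials `Σ z^{des} u^{LRmin}` over `A_n` and `B_n` agree (with `z = X 0`,
`u = X 1`); and if moreover `inv α = inv β`, the generating polynomials
`Σ z^{des} u^{LRmin} q^{inv}` over `A_n` and `B_n` agree (with `z = X 0`, `u = X 1`,
`q = X 2`). -/
theorem stmt15 {j : ℕ} (hj : 3 ≤ j) (α β : Equiv.Perm (Fin j))
    (hmm : MutuallyMinOverlapping α β)
    (a : ℕ) (ha1 : 1 ≤ a) (haj : a < j)
    (hpre : ∀ i : ℕ, ∀ hi : i < a, α ⟨i, by omega⟩ = β ⟨i, by omega⟩)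
    (hαa : α ⟨a - 1, by omega⟩ = ⟨0, by omega⟩)
    (hβa : β ⟨a - 1, by omega⟩ = ⟨0, by omega⟩)
    (hlast : α ⟨j - 1, by omega⟩ = β ⟨j - 1, by omega⟩)
    (hdes : des α = des β) :
    (∀ n : ℕ,
      (∑ σ ∈ Finset.univ.filter
          (fun σ : Equiv.Perm (Fin n) => 0 < mch α σ ∧ mch β σ = 0),
        (MvPolynomial.X 0 : MvPolynomial (Fin 2) ℚ) ^ des σ * MvPolynomial.X 1 ^ LRmin σ) =
      ∑ σ ∈ Finset.univ.filter
          (fun σ : Equiv.Perm (Fin n) => 0 < mch β σ ∧ mch α σ = 0),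
        (MvPolynomial.X 0 : MvPolynomial (Fin 2) ℚ) ^ des σ * MvPolynomial.X 1 ^ LRmin σ) ∧
    (inv α = inv β →
      ∀ n : ℕ,
        (∑ σ ∈ Finset.univ.filter
            (fun σ : Equiv.Perm (Fin n) => 0 < mch α σ ∧ mch β σ = 0),
          (MvPolynomial.X 0 : MvPolynomial (Fin 3) ℚ) ^ des σ * MvPolynomial.X 1 ^ LRmin σ *
            MvPolynomial.X 2 ^ inv σ) =
        ∑ σ ∈ Finset.univ.filter
            (fun σ : Equiv.Perm (Fin n) => 0 < mch β σ ∧ mch α σ = 0),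
          (MvPolynomial.X 0 : MvPolynomial (Fin 3) ℚ) ^ des σ * MvPolynomial.X 1 ^ LRmin σ *
            MvPolynomial.X 2 ^ inv σ) := by
  have hex : Exchangeable α β (a - 1) := by
    refine ⟨by omega, fun σ p q => hmm.1.apart (by omega) σ p q,
      fun σ p q => hmm.2.1.apart (by omega) σ p q,
      fun σ p q => hmm.apart (by omega) σ p q, by omega, ?_, ?_, hdes⟩
    · rintro ⟨b, hb⟩ (h | h)
      · exact hpre b (by simp only at h; omega)
      · obtain rfl : b = j - 1 := by simp only at h; omega
        exact hlast
    · intro b hb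
      rw [hαa, Fin.lt_def]
      refine Nat.pos_of_ne_zero fun h0 => hb (α.injective ?_)
      rw [hαa]
      exact Fin.ext h0
  refine ⟨fun n => ?_, fun hinv n => ?_⟩
  · obtain ⟨E, hE⟩ := hex.exists_equiv n
    refine Finset.sum_equiv E (fun σ => ?_) (fun σ _ => ?_)
    · simp only [Finset.mem_filter, Finset.mem_univ, true_and, hE σ]
    · rw [(hE σ).1, (hE σ).2.1]
  · obtain ⟨E, hE⟩ := hex.exists_equiv n
    refine Finset.sum_equiv E (fun σ => ?_) (fun σ _ => ?_)
    · simp only [Finset.mem_filter, Finset.mem_univ, true_and, hE σ]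
    · rw [(hE σ).1, (hE σ).2.1, (hE σ).2.2.1 hinv]


end CWilf
end
end
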